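/- (Saint-Venant inequality for convex bodies.) Let n ≥ 2 and let Ω ⊆ ℝⁿ be a nonempty bounded open convex set, and let B₁ denote the open unit ball of ℝⁿ. Then T(Ω)/|Ω|^{(n+2)/n} ≤ T(B₁)/|B₁|^{(n+2)/n}, and equality holds if and only if Ω is an open ball (i.e. Ω = B(x₀, r) for some x₀ ∈ ℝⁿ and r > 0). -/

import Mathlib

open MeasureTheory Set

noncomputable section

/-- n-dimensional Lebesgue measure of a set in ℝⁿ. -/
def volN (n : ℕ) (Ω : Set (EuclideanSpace ℝ (Fin n))) : ℝ := (volume Ω).toReal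

/-- Torsional rigidity of a region in ℝⁿ. -/
def torsionalRigidityN (n : ℕ) (Ω : Set (EuclideanSpace ℝ (Fin n))) : ℝ :=
  sSup {v : ℝ | ∃ u : EuclideanSpace ℝ (Fin n) → ℝ, ContDiff ℝ (⊤ : ℕ∞) u ∧
    HasCompactSupport u ∧ tsupport u ⊆ Ω ∧
    v = 2 * (∫ x in Ω, u x) - ∫ x in Ω, ‖gradient u x‖ ^ 2}

namespace SaintVenant

section Transport

variable {A B : ℝ → ℝ} {a b c d : ℝ}

theorem intervalIntegrable_of_integrableOn_Ioo (hab : a < b) (hint : IntegrableOn A (Ioo a b)) :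
    IntervalIntegrable A volume a b := by
  rw [intervalIntegrable_iff_integrableOn_Ioo_of_le hab.le]
  exact hint

theorem continuousOn_primitive_Icc (hab : a < b) (hint : IntegrableOn A (Ioo a b)) :
    ContinuousOn (fun t => ∫ s in a..t, A s) (Icc a b) := by
  have h := intervalIntegral.continuousOn_primitive_interval'
    (intervalIntegrable_of_integrableOn_Ioo hab hint) left_mem_uIcc
  rwa [uIcc_of_le hab.le] at h

theorem hasStrictDerivAt_primitive (hab : a < b) (hc : ContinuousOn A (Ioo a b))
    (hint : IntegrableOn A (Ioo a b)) {t : ℝ} (ht : t ∈ Ioo a b) :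
    HasStrictDerivAt (fun t => ∫ s in a..t, A s) (A t) t := by
  refine intervalIntegral.integral_hasStrictDerivAt_right ?_
    (hc.stronglyMeasurableAtFilter isOpen_Ioo t ht) (hc.continuousAt (isOpen_Ioo.mem_nhds ht))
  refine (intervalIntegrable_of_integrableOn_Ioo hab hint).mono_set ?_
  rw [uIcc_of_le hab.le, uIcc_of_le ht.1.le]
  exact Icc_subset_Icc_right ht.2.le

theorem strictMonoOn_primitive (hab : a < b) (hc : ContinuousOn A (Ioo a b))
    (hpos : ∀ t ∈ Ioo a b, 0 < A t) (hint : IntegrableOn A (Ioo a b)) :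
    StrictMonoOn (fun t => ∫ s in a..t, A s) (Icc a b) := by
  refine strictMonoOn_of_deriv_pos (convex_Icc a b) (continuousOn_primitive_Icc hab hint) ?_
  intro t ht
  rw [interior_Icc] at ht
  rw [(hasStrictDerivAt_primitive hab hc hint ht).hasDerivAt.deriv]
  exact hpos t ht

theorem primitive_right (hab : a < b) : ∫ s in a..b, A s = ∫ s in Ioo a b, A s := by
  rw [intervalIntegral.integral_of_le hab.le, integral_Ioc_eq_integral_Ioo]

theorem exists_primitive_eq (hab : a < b) (hint : IntegrableOn A (Ioo a b)) {q : ℝ}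
    (h0 : 0 < q) (h1 : q < ∫ s in Ioo a b, A s) :
    ∃ t ∈ Ioo a b, ∫ s in a..t, A s = q := by
  have h := intermediate_value_Ioo hab.le (continuousOn_primitive_Icc hab hint)
  simp only [intervalIntegral.integral_same, primitive_right hab] at h
  obtain ⟨t, ht, h2⟩ := h ⟨h0, h1⟩
  exact ⟨t, ht, h2⟩

theorem primitive_mem (hab : a < b) (hc : ContinuousOn A (Ioo a b))
    (hpos : ∀ t ∈ Ioo a b, 0 < A t) (hint : IntegrableOn A (Ioo a b)) {t : ℝ}
    (ht : t ∈ Ioo a b) :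
    0 < ∫ s in a..t, A s ∧ ∫ s in a..t, A s < ∫ s in Ioo a b, A s := by
  have hm := strictMonoOn_primitive hab hc hpos hint
  have h1 := hm (left_mem_Icc.2 hab.le) (Ioo_subset_Icc_self ht) ht.1
  have h2 := hm (Ioo_subset_Icc_self ht) (right_mem_Icc.2 hab.le) ht.2
  simp only [intervalIntegral.integral_same, primitive_right hab] at h1 h2
  exact ⟨h1, h2⟩

/-- The monotone map transporting the normalised density `A` on `(a, b)` to the normalised density
`B` on `(c, d)`. -/
theorem exists_monotone_transport (hab : a < b) (hcd : c < d)
    (hAc : ContinuousOn A (Ioo a b)) (hApos : ∀ t ∈ Ioo a b, 0 < A t)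
    (hAint : IntegrableOn A (Ioo a b))
    (hBc : ContinuousOn B (Ioo c d)) (hBpos : ∀ t ∈ Ioo c d, 0 < B t)
    (hBint : IntegrableOn B (Ioo c d)) :
    ∃ T : ℝ → ℝ, InjOn T (Ioo a b) ∧ T '' Ioo a b = Ioo c d ∧
      ∀ t ∈ Ioo a b, HasDerivAt T
        (((∫ s in Ioo c d, B s) / ∫ s in Ioo a b, A s) * A t / B (T t)) t := by
  set v := ∫ s in Ioo a b, A s with hv
  set w := ∫ s in Ioo c d, B s with hw
  have hv0 : 0 < v := by
    obtain ⟨t, ht⟩ := nonempty_Ioo.2 hab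
    have := primitive_mem hab hAc hApos hAint ht
    linarith [this.1, this.2]
  have hw0 : 0 < w := by
    obtain ⟨t, ht⟩ := nonempty_Ioo.2 hcd
    have := primitive_mem hcd hBc hBpos hBint ht
    linarith [this.1, this.2]
  have hex : ∀ t ∈ Ioo a b, ∃ s ∈ Ioo c d, ∫ x in c..s, B x = w / v * ∫ x in a..t, A x := by
    intro t ht
    have h := primitive_mem hab hAc hApos hAint ht
    refine exists_primitive_eq hcd hBint (by have := h.1; positivity) ?_
    rw [← hw, div_mul_eq_mul_div, div_lt_iff₀ hv0]
    exact mul_lt_mul_of_pos_left h.2 hw0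
  choose! T hTm hT using hex
  have hmA := strictMonoOn_primitive hab hAc hApos hAint
  have hmB := strictMonoOn_primitive hcd hBc hBpos hBint
  refine ⟨T, ?_, ?_, ?_⟩
  · intro t ht t' ht' h
    have h1 := hT t ht
    rw [h, hT t' ht'] at h1
    have h2 := mul_left_cancel₀ (by positivity) h1
    exact hmA.injOn (Ioo_subset_Icc_self ht) (Ioo_subset_Icc_self ht') h2.symm
  · apply Subset.antisymm
    · rintro _ ⟨t, ht, rfl⟩
      exact hTm t ht
    · intro s hs
      have h := primitive_mem hcd hBc hBpos hBint hs
      obtain ⟨t, ht, hte⟩ := exists_primitive_eq hab hAint (q := v / w * ∫ x in c..s, B x)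
        (by have := h.1; positivity)
        (by
          rw [← hv, div_mul_eq_mul_div, div_lt_iff₀ hw0]
          exact mul_lt_mul_of_pos_left h.2 hv0)
      refine ⟨t, ht, hmB.injOn (Ioo_subset_Icc_self (hTm t ht)) (Ioo_subset_Icc_self hs) ?_⟩
      change ∫ x in c..T t, B x = ∫ x in c..s, B x
      rw [hT t ht, hte]
      field_simp
  · intro t ht
    have hG := hasStrictDerivAt_primitive hcd hBc hBint (hTm t ht)
    have hB0 := (hBpos _ (hTm t ht)).ne'
    have hF := (hasStrictDerivAt_primitive hab hAc hAint ht).hasDerivAt.const_mul (w / v)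
    have hg := (hG.to_localInverse hB0).hasDerivAt
    have hr := hG.eventually_right_inverse hB0
    set g := HasStrictDerivAt.localInverse (fun t => ∫ s in c..t, B s) (B (T t)) (T t) hG hB0
    have hgT : g (∫ s in c..T t, B s) = T t := (hG.eventually_left_inverse hB0).self_of_nhds
    have hcomp : HasDerivAt (fun t => g (w / v * ∫ s in a..t, A s))
        ((B (T t))⁻¹ * (w / v * A t)) t := by
      refine HasDerivAt.comp t (h₂ := g) ?_ hF
      rw [← hT t ht]
      exact hg
    have hcont : ContinuousAt (fun t => g (w / v * ∫ s in a..t, A s)) t := hcomp.continuousAt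
    have hgt : g (w / v * ∫ s in a..t, A s) = T t := by rw [← hT t ht, hgT]
    have hev : T =ᶠ[nhds t] fun t => g (w / v * ∫ s in a..t, A s) := by
      have e1 := hcont.eventually_mem (s := Ioo c d)
        (isOpen_Ioo.mem_nhds (by rw [hgt]; exact hTm t ht))
      have e2 : ∀ᶠ y in nhds t, ∫ x in c..g (w / v * ∫ s in a..y, A s), B x =
          w / v * ∫ s in a..y, A s := by
        rw [hT t ht] at hr
        exact hF.continuousAt.eventually hr
      filter_upwards [e1, e2, isOpen_Ioo.mem_nhds ht] with y h1 h2 h3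
      refine hmB.injOn (Ioo_subset_Icc_self (hTm y h3)) (Ioo_subset_Icc_self h1) ?_
      change ∫ x in c..T y, B x = _
      rw [hT y h3]
      exact h2.symm
    refine (hcomp.congr_of_eventuallyEq hev).congr_deriv ?_
    field_simp

end Transport

/-- A nonempty bounded open convex set. -/
structure IsConvexDomain {E : Type*} [NormedAddCommGroup E] [NormedSpace ℝ E] (Ω : Set E) :
    Prop where
  nonempty : Ω.Nonempty
  isOpen : IsOpen Ω
  isBounded : Bornology.IsBounded Ω
  convex : Convex ℝ Ω

theorem IsConvexDomain.exists_eq_Ioo {I : Set ℝ} (h : IsConvexDomain I) :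
    ∃ a b, a < b ∧ I = Ioo a b := by
  have hb := h.isBounded.bddBelow
  have ha := h.isBounded.bddAbove
  have hI : I = Ioo (sInf I) (sSup I) := by
    apply Subset.antisymm
    · intro t ht
      obtain ⟨ε, hε, hs⟩ := Metric.isOpen_iff.1 h.isOpen t ht
      rw [Real.ball_eq_Ioo] at hs
      have h1 : t - ε / 2 ∈ I := hs ⟨by linarith, by linarith⟩
      have h2 : t + ε / 2 ∈ I := hs ⟨by linarith, by linarith⟩
      have h3 := csInf_le hb h1
      have h4 := le_csSup ha h2
      exact ⟨by linarith, by linarith⟩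
    · intro t ht
      obtain ⟨x, hx, hxt⟩ := exists_lt_of_csInf_lt h.nonempty ht.1
      obtain ⟨y, hy, hty⟩ := exists_lt_of_lt_csSup h.nonempty ht.2
      exact h.convex.ordConnected.out hx hy ⟨hxt.le, hty.le⟩
  refine ⟨sInf I, sSup I, ?_, hI⟩
  obtain ⟨t, ht⟩ := h.nonempty
  rw [hI] at ht
  exact ht.1.trans ht.2

theorem IsConvexDomain.measure_lt_top {V : Type*} [NormedAddCommGroup V] [NormedSpace ℝ V]
    [FiniteDimensional ℝ V] [MeasureSpace V] [(volume : Measure V).IsAddHaarMeasure] {Ω : Set V}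
    (h : IsConvexDomain Ω) : volume Ω < ⊤ :=
  h.isBounded.measure_lt_top

theorem IsConvexDomain.measureReal_pos {V : Type*} [NormedAddCommGroup V] [NormedSpace ℝ V]
    [FiniteDimensional ℝ V] [MeasureSpace V] [(volume : Measure V).IsAddHaarMeasure] {Ω : Set V}
    (h : IsConvexDomain Ω) : 0 < volume.real Ω :=
  ENNReal.toReal_pos (h.isOpen.measure_pos _ h.nonempty).ne' h.measure_lt_top.ne

section Slices

variable {V : Type*} [NormedAddCommGroup V] [NormedSpace ℝ V] {Ω : Set (ℝ × V)}

theorem IsConvexDomain.image_fst (h : IsConvexDomain Ω) : IsConvexDomain (Prod.fst '' Ω) where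
  nonempty := h.nonempty.image _
  isOpen := isOpenMap_fst _ h.isOpen
  isBounded := h.isBounded.image_fst
  convex := h.convex.linear_image (LinearMap.fst ℝ ℝ V)

theorem IsConvexDomain.slice (h : IsConvexDomain Ω) {t : ℝ} (ht : t ∈ Prod.fst '' Ω) :
    IsConvexDomain (Prod.mk t ⁻¹' Ω) where
  nonempty := by
    obtain ⟨⟨_, y⟩, hy, rfl⟩ := ht
    exact ⟨y, hy⟩
  isOpen := h.isOpen.preimage (by fun_prop)
  isBounded := h.isBounded.image_snd.subset fun y hy => ⟨(t, y), hy, rfl⟩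
  convex := by
    intro y hy z hz α β hα hβ hαβ
    have := h.convex hy hz hα hβ hαβ
    simpa [← add_mul, hαβ] using this

theorem IsConvexDomain.mem_closure_slice (h : IsConvexDomain Ω) {t : ℝ}
    (ht : t ∈ Prod.fst '' Ω) {y : V} (hy : (t, y) ∈ closure Ω) :
    y ∈ closure (Prod.mk t ⁻¹' Ω) := by
  obtain ⟨⟨t, z⟩, hz, rfl⟩ := ht
  have hsub : openSegment ℝ z y ⊆ Prod.mk t ⁻¹' Ω := by
    rintro _ ⟨α, β, hα, hβ, hαβ, rfl⟩
    have h1 := h.convex.combo_interior_closure_mem_interior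
      (by rwa [h.isOpen.interior_eq]) hy hα hβ.le hαβ
    rw [h.isOpen.interior_eq] at h1
    simpa [← add_mul, hαβ] using h1
  refine closure_mono hsub ?_
  rw [closure_openSegment]
  exact right_mem_segment ℝ z y

end Slices

section Fubini

variable {V : Type*} [NormedAddCommGroup V] [NormedSpace ℝ V] [FiniteDimensional ℝ V]
  [MeasureSpace V] [BorelSpace V] [(volume : Measure V).IsAddHaarMeasure]
  {Ω : Set (ℝ × V)} {f : ℝ × V → ℝ}

instance isAddHaarMeasure_volume_prod : (volume : Measure (ℝ × V)).IsAddHaarMeasure :=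
  inferInstanceAs ((volume : Measure ℝ).prod (volume : Measure V)).IsAddHaarMeasure

theorem IsConvexDomain.integrableOn_slice (h : IsConvexDomain Ω) (hf : IntegrableOn f Ω) :
    IntegrableOn (fun t => ∫ y in Prod.mk t ⁻¹' Ω, f (t, y)) (Prod.fst '' Ω) := by
  have h1 := ((integrable_indicator_iff h.isOpen.measurableSet).2 hf).integral_prod_left
  refine h1.integrableOn.congr_fun (fun t ht => ?_) h.image_fst.isOpen.measurableSet
  rw [← integral_indicator (h.slice ht).isOpen.measurableSet]
  rfl

theorem IsConvexDomain.setIntegral_eq_slice (h : IsConvexDomain Ω) (hf : IntegrableOn f Ω) :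
    ∫ p in Ω, f p = ∫ t in Prod.fst '' Ω, ∫ y in Prod.mk t ⁻¹' Ω, f (t, y) := by
  rw [← integral_indicator h.isOpen.measurableSet, Measure.volume_eq_prod,
    integral_prod _ ((integrable_indicator_iff h.isOpen.measurableSet).2 hf),
    ← integral_indicator h.image_fst.isOpen.measurableSet]
  congr 1
  ext t
  by_cases ht : t ∈ Prod.fst '' Ω
  · rw [indicator_of_mem ht, ← integral_indicator (h.slice ht).isOpen.measurableSet]
    rfl
  · rw [indicator_of_notMem ht]
    refine integral_eq_zero_of_ae (Filter.Eventually.of_forall fun y => ?_)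
    exact indicator_of_notMem (fun hy => ht ⟨_, hy, rfl⟩) _

theorem IsConvexDomain.integrableOn_volume_slice (h : IsConvexDomain Ω) :
    IntegrableOn (fun t => volume.real (Prod.mk t ⁻¹' Ω)) (Prod.fst '' Ω) := by
  have h1 := h.integrableOn_slice (f := fun _ => 1)
    (integrableOn_const h.measure_lt_top.ne)
  simpa using h1

theorem IsConvexDomain.integral_volume_slice (h : IsConvexDomain Ω) :
    ∫ t in Prod.fst '' Ω, volume.real (Prod.mk t ⁻¹' Ω) = volume.real Ω := by
  have h1 := h.setIntegral_eq_slice (f := fun _ => 1)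
    (integrableOn_const h.measure_lt_top.ne)
  simpa using h1.symm

theorem IsConvexDomain.continuousOn_volume_slice (h : IsConvexDomain Ω) :
    ContinuousOn (fun t => volume.real (Prod.mk t ⁻¹' Ω)) (Prod.fst '' Ω) := by
  have heq : (fun t => volume.real (Prod.mk t ⁻¹' Ω)) =
      fun t => ∫ y, Ω.indicator (fun _ => (1 : ℝ)) (t, y) := by
    ext t
    have hm : MeasurableSet (Prod.mk t ⁻¹' Ω) := h.isOpen.measurableSet.preimage (by fun_prop)
    rw [← integral_indicator_one hm]
    rfl
  intro t ht
  refine ContinuousAt.continuousWithinAt ?_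
  rw [heq]
  have hS : MeasurableSet (Prod.snd '' Ω) := (isOpenMap_snd _ h.isOpen).measurableSet
  refine continuousAt_of_dominated (bound := (Prod.snd '' Ω).indicator fun _ => 1)
    (Filter.Eventually.of_forall fun s => ?_) (Filter.Eventually.of_forall fun s => ?_) ?_ ?_
  · exact ((measurable_const.indicator h.isOpen.measurableSet).comp
      measurable_prodMk_left).aestronglyMeasurable
  · refine Filter.Eventually.of_forall fun y => ?_
    by_cases hy : (s, y) ∈ Ω
    · rw [indicator_of_mem hy, indicator_of_mem (mem_image_of_mem Prod.snd hy)]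
      simp
    · rw [indicator_of_notMem hy, norm_zero]
      exact indicator_nonneg (fun _ _ => zero_le_one) _
  · exact (integrable_indicator_iff hS).2
      (integrableOn_const h.isBounded.image_snd.measure_lt_top.ne)
  · have hfr := (h.slice ht).convex.addHaar_frontier volume
    filter_upwards [measure_eq_zero_iff_ae_notMem.1 hfr] with y hy
    have hcont : Continuous fun s : ℝ => (s, y) := by fun_prop
    by_cases hyΩ : (t, y) ∈ Ω
    · refine continuousAt_const.congr (f := fun _ => (1 : ℝ)) ?_
      filter_upwards [hcont.continuousAt.eventually_mem (h.isOpen.mem_nhds hyΩ)] with s hs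
      rw [indicator_of_mem hs]
    · have hyc : (t, y) ∉ closure Ω := fun hc => hy
        ⟨h.mem_closure_slice ht hc, fun hi => hyΩ (interior_subset (s := Prod.mk t ⁻¹' Ω) hi)⟩
      refine continuousAt_const.congr (f := fun _ => (0 : ℝ)) ?_
      filter_upwards [hcont.continuousAt.eventually_mem
        (isClosed_closure.isOpen_compl.mem_nhds hyc)] with s hs
      rw [indicator_of_notMem fun hm => hs (subset_closure hm)]

end Fubini

theorem hasCompactSupport_slice_left {X Y : Type*} [TopologicalSpace X] [R1Space X]
    [TopologicalSpace Y] {u : X × Y → ℝ} (hu : HasCompactSupport u) (y : Y) :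
    HasCompactSupport fun t => u (t, y) :=
  HasCompactSupport.intro (hu.isCompact.image continuous_fst) fun _ ht =>
    image_eq_zero_of_notMem_tsupport fun h => ht ⟨_, h, rfl⟩

theorem hasCompactSupport_slice_right {X Y : Type*} [TopologicalSpace X]
    [TopologicalSpace Y] [R1Space Y] {u : X × Y → ℝ} (hu : HasCompactSupport u) (t : X) :
    HasCompactSupport fun y => u (t, y) :=
  HasCompactSupport.intro (hu.isCompact.image continuous_snd) fun _ hy =>
    image_eq_zero_of_notMem_tsupport fun h => hy ⟨_, h, rfl⟩

theorem continuous_mul_of_tsupport {X Y : Type*} [TopologicalSpace X] [TopologicalSpace Y]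
    {S : X → ℝ} {I : Set X} {g : Y → X} {u : Y → ℝ} (hI : IsOpen I) (hS : ContinuousOn S I)
    (hg : Continuous g) (hu : Continuous u) (hsub : ∀ p ∈ tsupport u, g p ∈ I) :
    Continuous fun p => S (g p) * u p := by
  rw [continuous_iff_continuousAt]
  intro p
  by_cases hp : p ∈ tsupport u
  · exact ((hS.continuousAt (hI.mem_nhds (hsub p hp))).comp hg.continuousAt).mul hu.continuousAt
  · refine (continuousAt_const (y := (0 : ℝ))).congr ?_
    filter_upwards [notMem_tsupport_iff_eventuallyEq.1 hp] with q hq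
    simp [hq]

theorem hasCompactSupport_sq {X : Type*} [TopologicalSpace X] {f : X → ℝ}
    (hf : HasCompactSupport f) : HasCompactSupport fun x => f x ^ 2 := by
  simp only [pow_two]
  exact hf.mul_left

section Step

variable {V : Type*} [NormedAddCommGroup V] [NormedSpace ℝ V] [FiniteDimensional ℝ V]
  [MeasureSpace V] [BorelSpace V] [(volume : Measure V).IsAddHaarMeasure]
  {Ω K : Set (ℝ × V)} {u : ℝ × V → ℝ} {S S' : ℝ → ℝ} {I : Set ℝ}

theorem continuous_fderiv_apply_of_contDiff {E : Type*} [NormedAddCommGroup E]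
    [NormedSpace ℝ E] {u : E → ℝ} (hu : ContDiff ℝ 1 u) (v : E) :
    Continuous fun p => fderiv ℝ u p v :=
  (hu.continuous_fderiv one_ne_zero).clm_apply continuous_const

theorem tsupport_fderiv_apply_subset {E : Type*} [NormedAddCommGroup E]
    [NormedSpace ℝ E] (u : E → ℝ) (v : E) :
    tsupport (fun p => fderiv ℝ u p v) ⊆ tsupport u :=
  closure_minimal (fun p hp => by
    by_contra h
    exact hp (by simp [fderiv_of_notMem_tsupport (𝕜 := ℝ) h])) (isClosed_tsupport u)

theorem hasCompactSupport_fderiv_apply {E : Type*} [NormedAddCommGroup E]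
    [NormedSpace ℝ E] {u : E → ℝ} (hu : HasCompactSupport u) (v : E) :
    HasCompactSupport fun p => fderiv ℝ u p v :=
  hu.of_isClosed_subset (isClosed_tsupport _) (tsupport_fderiv_apply_subset u v)

theorem integral_deriv_mul_eq_neg (hI : IsOpen I) (hS : ∀ t ∈ I, HasDerivAt S (S' t) t)
    (hS' : ContinuousOn S' I) (hu : ContDiff ℝ 1 u) (huc : HasCompactSupport u)
    (hsub : ∀ p ∈ tsupport u, p.1 ∈ I) :
    ∫ p, S' p.1 * u p = -∫ p, S p.1 * fderiv ℝ u p (1, 0) := by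
  have hSc : ContinuousOn S I := fun t ht => (hS t ht).continuousAt.continuousWithinAt
  have c1 : Continuous fun p : ℝ × V => S' p.1 * u p :=
    continuous_mul_of_tsupport hI hS' continuous_fst hu.continuous hsub
  have c2 : Continuous fun p : ℝ × V => S p.1 * fderiv ℝ u p (1, 0) :=
    continuous_mul_of_tsupport hI hSc continuous_fst (continuous_fderiv_apply_of_contDiff hu _)
      fun p hp => hsub p (tsupport_fderiv_apply_subset u _ hp)
  have c3 : Continuous fun p : ℝ × V => S p.1 * u p :=
    continuous_mul_of_tsupport hI hSc continuous_fst hu.continuous hsub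
  have s1 : HasCompactSupport fun p : ℝ × V => S' p.1 * u p := huc.mul_left
  have s2 : HasCompactSupport fun p : ℝ × V => S p.1 * fderiv ℝ u p (1, 0) :=
    (hasCompactSupport_fderiv_apply huc _).mul_left
  have s3 : HasCompactSupport fun p : ℝ × V => S p.1 * u p := huc.mul_left
  have i1 := c1.integrable_of_hasCompactSupport s1 (μ := volume)
  have i2 := c2.integrable_of_hasCompactSupport s2 (μ := volume)
  have key : ∫ p : ℝ × V, (S' p.1 * u p + S p.1 * fderiv ℝ u p (1, 0)) = 0 := by
    rw [Measure.volume_eq_prod, integral_prod_symm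
      (fun p : ℝ × V => S' p.1 * u p + S p.1 * fderiv ℝ u p (1, 0))
      (i1.add i2)]
    refine integral_eq_zero_of_ae (Filter.Eventually.of_forall fun y => ?_)
    refine integral_eq_zero_of_hasDerivAt_of_integrable (f := fun t => S t * u (t, y)) ?_ ?_ ?_
    · intro t
      by_cases ht : (t, y) ∈ tsupport u
      · have h1 : HasDerivAt (fun t : ℝ => (t, y)) ((1 : ℝ), (0 : V)) t :=
          (hasDerivAt_id t).prodMk (hasDerivAt_const t y)
        have h2 := (hu.differentiable one_ne_zero (t, y)).hasFDerivAt.comp_hasDerivAt t h1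
        exact (hS t (hsub _ ht)).mul h2
      · rw [fderiv_of_notMem_tsupport (𝕜 := ℝ) ht, image_eq_zero_of_notMem_tsupport ht]
        simp only [mul_zero, zero_apply, add_zero]
        refine (hasDerivAt_const t (0 : ℝ)).congr_of_eventuallyEq ?_
        have hc : Continuous fun s : ℝ => (s, y) := by fun_prop
        filter_upwards [hc.continuousAt.eventually (notMem_tsupport_iff_eventuallyEq.1 ht)]
          with s hs
        simp [hs]
    · exact ((c1.add c2).comp (by fun_prop : Continuous fun t : ℝ => (t, y))
        ).integrable_of_hasCompactSupport (hasCompactSupport_slice_left (s1.add s2) y)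
    · exact (c3.comp (by fun_prop : Continuous fun t : ℝ => (t, y))
        ).integrable_of_hasCompactSupport (hasCompactSupport_slice_left s3 y)
  rw [integral_add i1 i2] at key
  linarith

theorem integral_deriv_mul_le (hΩ : IsConvexDomain Ω)
    (hS : ∀ t ∈ Prod.fst '' Ω, HasDerivAt S (S' t) t)
    (hS' : ContinuousOn S' (Prod.fst '' Ω)) {C : ℝ} (hC : ∀ t ∈ Prod.fst '' Ω, |S t| ≤ C)
    (hu : ContDiff ℝ 1 u) (huc : HasCompactSupport u) (hsub : tsupport u ⊆ Ω) (c : ℝ) :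
    2 * c * ∫ p, S' p.1 * u p ≤ (∫ p, fderiv ℝ u p (1, 0) ^ 2) +
      c ^ 2 * ∫ t in Prod.fst '' Ω, S t ^ 2 * volume.real (Prod.mk t ⁻¹' Ω) := by
  have hI := hΩ.image_fst.isOpen
  have hsubI : ∀ p ∈ tsupport u, p.1 ∈ Prod.fst '' Ω := fun p hp => mem_image_of_mem _ (hsub hp)
  have hSc : ContinuousOn S (Prod.fst '' Ω) :=
    fun t ht => (hS t ht).continuousAt.continuousWithinAt
  rw [integral_deriv_mul_eq_neg hI hS hS' hu huc hsubI]
  have cd := continuous_fderiv_apply_of_contDiff hu ((1, 0) : ℝ × V)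
  have sd := hasCompactSupport_fderiv_apply huc ((1, 0) : ℝ × V)
  have c2 : Continuous fun p : ℝ × V => S p.1 * fderiv ℝ u p (1, 0) :=
    continuous_mul_of_tsupport hI hSc continuous_fst cd
      fun p hp => hsubI p (tsupport_fderiv_apply_subset u _ hp)
  have i2 := c2.integrable_of_hasCompactSupport sd.mul_left (μ := volume)
  have id2 : Integrable fun p => fderiv ℝ u p (1, 0) ^ 2 :=
    (cd.pow 2).integrable_of_hasCompactSupport (hasCompactSupport_sq sd)
  have iS : IntegrableOn (fun p : ℝ × V => S p.1 ^ 2) Ω := by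
    refine IntegrableOn.of_bound (C := C ^ 2) hΩ.measure_lt_top ?_ ?_
    · have h : ContinuousOn (fun p : ℝ × V => S p.1 ^ 2) Ω :=
        (hSc.comp continuousOn_fst fun p hp => mem_image_of_mem _ hp).pow 2
      exact h.aestronglyMeasurable hΩ.isOpen.measurableSet
    · filter_upwards [ae_restrict_mem hΩ.isOpen.measurableSet] with p hp
      rw [norm_pow, Real.norm_eq_abs]
      exact pow_le_pow_left₀ (abs_nonneg _) (hC _ (mem_image_of_mem _ hp)) 2
  have hS2 : ∫ t in Prod.fst '' Ω, S t ^ 2 * volume.real (Prod.mk t ⁻¹' Ω) =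
      ∫ p in Ω, S p.1 ^ 2 := by
    rw [hΩ.setIntegral_eq_slice iS]
    refine setIntegral_congr_fun hI.measurableSet fun t _ => ?_
    simp [mul_comm]
  have e1 : ∫ p, S p.1 * fderiv ℝ u p (1, 0) = ∫ p in Ω, S p.1 * fderiv ℝ u p (1, 0) := by
    refine (setIntegral_eq_integral_of_forall_compl_eq_zero fun p hp => ?_).symm
    rw [fderiv_of_notMem_tsupport (𝕜 := ℝ) fun h => hp (hsub h)]
    simp
  have e2 : ∫ p in Ω, fderiv ℝ u p (1, 0) ^ 2 ≤ ∫ p, fderiv ℝ u p (1, 0) ^ 2 :=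
    setIntegral_le_integral id2 (Filter.Eventually.of_forall fun p => sq_nonneg _)
  rw [hS2, e1]
  have e3 : ∫ p in Ω, (-(2 * c)) * (S p.1 * fderiv ℝ u p (1, 0)) ≤
      ∫ p in Ω, (fderiv ℝ u p (1, 0) ^ 2 + c ^ 2 * S p.1 ^ 2) := by
    refine integral_mono (i2.integrableOn.const_mul _)
      (id2.integrableOn.add (iS.const_mul _)) fun p => ?_
    change -(2 * c) * (S p.1 * fderiv ℝ u p (1, 0)) ≤
      fderiv ℝ u p (1, 0) ^ 2 + c ^ 2 * S p.1 ^ 2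
    nlinarith [sq_nonneg (fderiv ℝ u p (1, 0) + c * S p.1)]
  rw [integral_add id2.integrableOn (iS.const_mul _), integral_const_mul, integral_const_mul]
    at e3
  linarith

theorem integral_le_of_slices (hΩ : IsConvexDomain Ω) (hK : IsConvexDomain K)
    {T : ℝ → ℝ} (hTinj : InjOn T (Prod.fst '' Ω)) (hTim : T '' (Prod.fst '' Ω) = Prod.fst '' K)
    (hT : ∀ t ∈ Prod.fst '' Ω, HasDerivAt T (volume.real K / volume.real Ω *
      volume.real (Prod.mk t ⁻¹' Ω) / volume.real (Prod.mk (T t) ⁻¹' K)) t)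
    (hS : ∀ t ∈ Prod.fst '' Ω, HasDerivAt S (S' t) t)
    (hS' : ContinuousOn S' (Prod.fst '' Ω)) {C : ℝ} (hC : ∀ t ∈ Prod.fst '' Ω, |S t| ≤ C)
    (hu : ContDiff ℝ 1 u) (huc : HasCompactSupport u) (hsub : tsupport u ⊆ Ω) (hu0 : ∀ p, 0 ≤ u p)
    {c θ : ℝ} (hc : 0 ≤ c) {D : ℝ × V → ℝ} (hD : Integrable D) (hD0 : ∀ p, 0 ≤ D p)
    {N : V → ℝ} (hN : IntegrableOn (fun p : ℝ × V => N p.2) K) {l : ℝ → ℝ}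
    (hslice : ∀ t ∈ Prod.fst '' Ω, 2 * c * l t * ∫ y, u (t, y) ≤ (∫ y, D (t, y)) +
      c ^ 2 * (volume.real (Prod.mk t ⁻¹' Ω) / volume.real (Prod.mk (T t) ⁻¹' K) *
        ∫ y in Prod.mk (T t) ⁻¹' K, N y))
    (hθ : ∀ t ∈ Prod.fst '' Ω, θ ≤ l t + S' t) :
    2 * c * θ * ∫ p, u p ≤ (∫ p, D p) + (∫ p, fderiv ℝ u p (1, 0) ^ 2) +
      c ^ 2 * (volume.real Ω / volume.real K * (∫ p in K, N p.2) +
        ∫ t in Prod.fst '' Ω, S t ^ 2 * volume.real (Prod.mk t ⁻¹' Ω)) := by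
  have hI := hΩ.image_fst.isOpen
  have hsubI : ∀ p ∈ tsupport u, p.1 ∈ Prod.fst '' Ω := fun p hp => mem_image_of_mem _ (hsub hp)
  have hv := hΩ.measureReal_pos
  have hw := hK.measureReal_pos
  have hTm : ∀ t ∈ Prod.fst '' Ω, T t ∈ Prod.fst '' K :=
    fun t ht => hTim ▸ mem_image_of_mem T ht
  have hA : ∀ t ∈ Prod.fst '' Ω, 0 < volume.real (Prod.mk t ⁻¹' Ω) :=
    fun t ht => (hΩ.slice ht).measureReal_pos
  have hB : ∀ t ∈ Prod.fst '' Ω, 0 < volume.real (Prod.mk (T t) ⁻¹' K) :=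
    fun t ht => (hK.slice (hTm t ht)).measureReal_pos
  have iu := hu.continuous.integrable_of_hasCompactSupport huc (μ := volume)
  have c1 : Continuous fun p : ℝ × V => S' p.1 * u p :=
    continuous_mul_of_tsupport hI hS' continuous_fst hu.continuous hsubI
  have i1 := c1.integrable_of_hasCompactSupport huc.mul_left (μ := volume)
  have hu_off : ∀ t ∉ Prod.fst '' Ω, ∀ y, u (t, y) = 0 := fun t ht y =>
    image_eq_zero_of_notMem_tsupport fun h => ht (hsubI _ h)
  have eU : ∫ t in Prod.fst '' Ω, ∫ y, u (t, y) = ∫ p, u p := by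
    rw [Measure.volume_eq_prod, integral_prod _ iu]
    refine setIntegral_eq_integral_of_forall_compl_eq_zero fun t ht => ?_
    simp [hu_off t ht]
  have eSU : ∫ t in Prod.fst '' Ω, ∫ y, S' t * u (t, y) = ∫ p, S' p.1 * u p := by
    rw [Measure.volume_eq_prod, integral_prod _ i1]
    refine setIntegral_eq_integral_of_forall_compl_eq_zero fun t ht => ?_
    simp [hu_off t ht]
  have eD : ∫ t in Prod.fst '' Ω, ∫ y, D (t, y) ≤ ∫ p, D p := by
    rw [Measure.volume_eq_prod, integral_prod _ hD]
    exact setIntegral_le_integral hD.integral_prod_left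
      (Filter.Eventually.of_forall fun t => integral_nonneg fun y => hD0 _)
  have habs : ∀ t ∈ Prod.fst '' Ω, |volume.real K / volume.real Ω *
      volume.real (Prod.mk t ⁻¹' Ω) / volume.real (Prod.mk (T t) ⁻¹' K)| •
        (∫ y in Prod.mk (T t) ⁻¹' K, N y) = volume.real K / volume.real Ω *
      (volume.real (Prod.mk t ⁻¹' Ω) / volume.real (Prod.mk (T t) ⁻¹' K) *
        ∫ y in Prod.mk (T t) ⁻¹' K, N y) := fun t ht => by
    have := hA t ht
    have := hB t ht
    rw [abs_of_pos (by positivity), smul_eq_mul]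
    ring
  have hT' := fun t ht => (hT t ht).hasDerivWithinAt (s := Prod.fst '' Ω)
  have iN : IntegrableOn (fun t => volume.real (Prod.mk t ⁻¹' Ω) /
      volume.real (Prod.mk (T t) ⁻¹' K) * ∫ y in Prod.mk (T t) ⁻¹' K, N y) (Prod.fst '' Ω) := by
    have h := hK.integrableOn_slice hN
    rw [← hTim, integrableOn_image_iff_integrableOn_abs_deriv_smul hI.measurableSet hT' hTinj,
      integrableOn_congr_fun habs hI.measurableSet] at h
    have h2 := h.const_mul (volume.real Ω / volume.real K)
    refine h2.congr (Filter.Eventually.of_forall fun t => ?_)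
    simp only
    field_simp
  have eN : ∫ t in Prod.fst '' Ω, (volume.real (Prod.mk t ⁻¹' Ω) /
      volume.real (Prod.mk (T t) ⁻¹' K) * ∫ y in Prod.mk (T t) ⁻¹' K, N y) =
      volume.real Ω / volume.real K * ∫ p in K, N p.2 := by
    rw [hK.setIntegral_eq_slice hN, ← hTim,
      integral_image_eq_integral_abs_deriv_smul hI.measurableSet hT' hTinj,
      setIntegral_congr_fun hI.measurableSet habs, integral_const_mul]
    field_simp
  have hpt : ∀ t ∈ Prod.fst '' Ω, 2 * c * θ * (∫ y, u (t, y)) ≤ (∫ y, D (t, y)) +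
      c ^ 2 * (volume.real (Prod.mk t ⁻¹' Ω) / volume.real (Prod.mk (T t) ⁻¹' K) *
        ∫ y in Prod.mk (T t) ⁻¹' K, N y) + 2 * c * ∫ y, S' t * u (t, y) := by
    intro t ht
    have h1 := hslice t ht
    have h2 : 0 ≤ ∫ y, u (t, y) := integral_nonneg fun y => hu0 _
    have h3 := mul_le_mul_of_nonneg_left (hθ t ht) (mul_nonneg (mul_nonneg zero_le_two hc) h2)
    rw [integral_const_mul]
    nlinarith
  have iU : IntegrableOn (fun t => ∫ y, u (t, y)) (Prod.fst '' Ω) :=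
    iu.integral_prod_left.integrableOn
  have iSU : IntegrableOn (fun t => ∫ y, S' t * u (t, y)) (Prod.fst '' Ω) :=
    i1.integral_prod_left.integrableOn
  have iD : IntegrableOn (fun t => ∫ y, D (t, y)) (Prod.fst '' Ω) :=
    hD.integral_prod_left.integrableOn
  have hint := setIntegral_mono_on (iU.const_mul (2 * c * θ))
    ((iD.add (iN.const_mul (c ^ 2))).add (iSU.const_mul (2 * c))) hI.measurableSet hpt
  rw [integral_add' (iD.add (iN.const_mul (c ^ 2))) (iSU.const_mul (2 * c)),
    integral_add' iD (iN.const_mul (c ^ 2)), integral_const_mul, integral_const_mul,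
    integral_const_mul, eU, eSU, eN] at hint
  have := integral_deriv_mul_le hΩ hS hS' hC hu huc hsub c
  linarith

end Step

/-- The squared Euclidean norm of the gradient, in coordinates. -/
def gradSq {n : ℕ} (u : (Fin n → ℝ) → ℝ) (x : Fin n → ℝ) : ℝ :=
  ∑ i, fderiv ℝ u x (Pi.single i 1) ^ 2

section Transport

variable {V : Type*} [MeasureSpace V] {Ω K : Set (ℝ × V)} {T : ℝ → ℝ}

/-- `T` is the first component of the Knothe map from `Ω` to `K`. -/
structure IsFirstTransport (Ω K : Set (ℝ × V)) (T : ℝ → ℝ) : Prop where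
  injOn : InjOn T (Prod.fst '' Ω)
  image : T '' (Prod.fst '' Ω) = Prod.fst '' K
  hasDerivAt : ∀ t ∈ Prod.fst '' Ω, HasDerivAt T (volume.real K / volume.real Ω *
      volume.real (Prod.mk t ⁻¹' Ω) / volume.real (Prod.mk (T t) ⁻¹' K)) t

theorem IsFirstTransport.mem (h : IsFirstTransport Ω K T) {t : ℝ} (ht : t ∈ Prod.fst '' Ω) :
    T t ∈ Prod.fst '' K :=
  h.image ▸ mem_image_of_mem T ht

theorem IsFirstTransport.continuousOn (h : IsFirstTransport Ω K T) :
    ContinuousOn T (Prod.fst '' Ω) :=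
  fun t ht => (h.hasDerivAt t ht).continuousAt.continuousWithinAt

variable [NormedAddCommGroup V] [NormedSpace ℝ V]

theorem IsFirstTransport.exists_bound (h : IsFirstTransport Ω K T) (hK : IsConvexDomain K) :
    ∃ C, ∀ t ∈ Prod.fst '' Ω, |T t| ≤ C := by
  obtain ⟨C, hC⟩ := hK.image_fst.isBounded.exists_norm_le
  exact ⟨C, fun t ht => hC _ (h.mem ht)⟩

variable [FiniteDimensional ℝ V] [BorelSpace V] [(volume : Measure V).IsAddHaarMeasure]

theorem exists_isFirstTransport (hΩ : IsConvexDomain Ω) (hK : IsConvexDomain K) :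
    ∃ T, IsFirstTransport Ω K T := by
  obtain ⟨a, b, hab, hI⟩ := hΩ.image_fst.exists_eq_Ioo
  obtain ⟨c, d, hcd, hJ⟩ := hK.image_fst.exists_eq_Ioo
  have a1 := hΩ.continuousOn_volume_slice
  have a2 : ∀ t ∈ Prod.fst '' Ω, 0 < volume.real (Prod.mk t ⁻¹' Ω) :=
    fun t ht => (hΩ.slice ht).measureReal_pos
  have a3 := hΩ.integrableOn_volume_slice
  have a4 := hΩ.integral_volume_slice
  have b1 := hK.continuousOn_volume_slice
  have b2 : ∀ t ∈ Prod.fst '' K, 0 < volume.real (Prod.mk t ⁻¹' K) :=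
    fun t ht => (hK.slice ht).measureReal_pos
  have b3 := hK.integrableOn_volume_slice
  have b4 := hK.integral_volume_slice
  rw [hI] at a1 a2 a3 a4
  rw [hJ] at b1 b2 b3 b4
  obtain ⟨T, h1, h2, h3⟩ := exists_monotone_transport hab hcd a1 a2 a3 b1 b2 b3
  rw [a4, b4] at h3
  rw [← hI] at h1 h2 h3
  rw [← hJ] at h2
  exact ⟨T, h1, h2, h3⟩

theorem IsFirstTransport.continuousOn_deriv (h : IsFirstTransport Ω K T)
    (hΩ : IsConvexDomain Ω) (hK : IsConvexDomain K) :
    ContinuousOn (fun t => volume.real K / volume.real Ω *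
      volume.real (Prod.mk t ⁻¹' Ω) / volume.real (Prod.mk (T t) ⁻¹' K)) (Prod.fst '' Ω) := by
  refine (continuousOn_const.mul hΩ.continuousOn_volume_slice).div ?_ fun t ht =>
    (hK.slice (h.mem ht)).measureReal_pos.ne'
  exact hK.continuousOn_volume_slice.comp h.continuousOn fun t ht => h.mem ht

theorem IsFirstTransport.integral_comp (h : IsFirstTransport Ω K T) (hΩ : IsConvexDomain Ω)
    (hK : IsConvexDomain K) {g : ℝ → ℝ} (hg : Continuous g) :
    ∫ t in Prod.fst '' Ω, g (T t) * volume.real (Prod.mk t ⁻¹' Ω) =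
      volume.real Ω / volume.real K * ∫ p in K, g p.1 := by
  have hv := hΩ.measureReal_pos
  have hw := hK.measureReal_pos
  have hI := hΩ.image_fst.isOpen.measurableSet
  have hint : IntegrableOn (fun p : ℝ × V => g p.1) K :=
    ((hg.comp continuous_fst).continuousOn.integrableOn_compact
      hK.isBounded.isCompact_closure).mono_set subset_closure
  rw [hK.setIntegral_eq_slice hint, ← h.image, integral_image_eq_integral_abs_deriv_smul hI
    (fun t ht => (h.hasDerivAt t ht).hasDerivWithinAt) h.injOn, ← integral_const_mul]
  refine setIntegral_congr_fun hI fun t ht => ?_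
  have h1 := (hΩ.slice ht).measureReal_pos
  have h2 := (hK.slice (h.mem ht)).measureReal_pos
  simp only [setIntegral_const, smul_eq_mul]
  rw [abs_of_pos (by positivity)]
  field_simp

end Transport

theorem nat_mul_rpow_add_ge {m : ℕ} {β κ : ℝ} (hβ : 0 < β) (hκ : 0 < κ)
    (h0 : m = 0 → β = 1) :
    ((m + 1 : ℕ) : ℝ) * κ ^ (1 / ((m + 1 : ℕ) : ℝ)) ≤ m * β ^ (1 / (m : ℝ)) + κ / β := by
  rcases Nat.eq_zero_or_pos m with rfl | hm
  · simp [h0 rfl]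
  have hm' : (0 : ℝ) < m := by exact_mod_cast hm
  have h := Real.geom_mean_le_arith_mean2_weighted (w₁ := m / (m + 1)) (w₂ := 1 / (m + 1))
    (p₁ := β ^ (1 / (m : ℝ))) (p₂ := κ / β) (by positivity) (by positivity) (by positivity)
    (by positivity) (by field_simp)
  have e : (β ^ (1 / (m : ℝ))) ^ (m / (m + 1) : ℝ) * (κ / β) ^ (1 / (m + 1) : ℝ) =
      κ ^ (1 / (m + 1) : ℝ) := by
    rw [← Real.rpow_mul hβ.le, show 1 / (m : ℝ) * (m / (m + 1)) = 1 / (m + 1) by field_simp,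
      ← Real.mul_rpow hβ.le (by positivity), mul_div_cancel₀ _ hβ.ne']
  rw [e] at h
  push_cast
  have h2 := mul_le_mul_of_nonneg_left h (by positivity : (0 : ℝ) ≤ m + 1)
  refine h2.trans_eq ?_
  field_simp

theorem nat_mul_rpow_add_gt {m : ℕ} (hm : 0 < m) {β : ℝ} (hβ : 0 < β) (hβ1 : β ≠ 1) :
    ((m + 1 : ℕ) : ℝ) < m * β ^ (1 / (m : ℝ)) + 1 / β := by
  have hm' : (0 : ℝ) < m := by exact_mod_cast hm
  have hne : β ^ (1 / (m : ℝ)) ≠ 1 / β := by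
    intro h
    have h2 : β ^ (1 / (m : ℝ) + 1) = 1 := by
      rw [Real.rpow_add hβ, h, Real.rpow_one]
      field_simp
    have hx : 1 / (m : ℝ) + 1 ≠ 0 := by positivity
    exact hβ1 (Real.rpow_left_injOn hx hβ.le (zero_le_one' ℝ) (by simpa using h2))
  have h := (Real.geom_mean_lt_arith_mean2_weighted_iff_of_pos (w₁ := m / (m + 1))
    (w₂ := 1 / (m + 1)) (p₁ := β ^ (1 / (m : ℝ))) (p₂ := 1 / β) (by positivity) (by positivity)
    (by positivity) (by positivity) (by field_simp)).2 hne
  have e : (β ^ (1 / (m : ℝ))) ^ (m / (m + 1) : ℝ) * (1 / β) ^ (1 / (m + 1) : ℝ) = 1 := by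
    rw [← Real.rpow_mul hβ.le, show 1 / (m : ℝ) * (m / (m + 1)) = 1 / (m + 1) by field_simp,
      ← Real.mul_rpow hβ.le (by positivity), mul_div_cancel₀ _ hβ.ne', Real.one_rpow]
  rw [e] at h
  push_cast
  have h2 := mul_lt_mul_of_pos_left h (by positivity : (0 : ℝ) < m + 1)
  refine (by linarith : (m + 1 : ℝ) ≤ (m + 1) * 1).trans_lt (h2.trans_eq ?_)
  field_simp

/-- The energy inequality obtained by transporting the uniform measure of `Ω` to that of `K`. -/
def EnergyInequality (n : ℕ) : Prop :=
  ∀ (Ω K : Set (Fin n → ℝ)), IsConvexDomain Ω → IsConvexDomain K →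
    ∀ u : (Fin n → ℝ) → ℝ, ContDiff ℝ 1 u → HasCompactSupport u → tsupport u ⊆ Ω →
      (∀ x, 0 ≤ u x) → ∀ c : ℝ, 0 ≤ c →
      2 * c * (n * (volume.real K / volume.real Ω) ^ (1 / (n : ℝ))) * ∫ x, u x ≤
        (∫ x, gradSq u x) +
          c ^ 2 * (volume.real Ω / volume.real K * ∫ y in K, ∑ i, y i ^ 2)

section Step

variable {m : ℕ} {Ω K : Set (ℝ × (Fin m → ℝ))} {u : ℝ × (Fin m → ℝ) → ℝ} {S S' T : ℝ → ℝ}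

theorem gradSq_slice (hu : ContDiff ℝ 1 u) (t : ℝ) (y : Fin m → ℝ) :
    gradSq (fun y => u (t, y)) y = ∑ i, fderiv ℝ u (t, y) (0, Pi.single i 1) ^ 2 := by
  have h := ((hu.differentiable one_ne_zero (t, y)).hasFDerivAt.comp y
    (hasFDerivAt_prodMk_right t y)).fderiv
  have h2 : u ∘ Prod.mk t = fun y => u (t, y) := rfl
  rw [h2] at h
  simp only [gradSq, h]
  simp

theorem EnergyInequality.step (hm : EnergyInequality m) (hΩ : IsConvexDomain Ω)
    (hK : IsConvexDomain K) (hT : IsFirstTransport Ω K T)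
    (hS : ∀ t ∈ Prod.fst '' Ω, HasDerivAt S (S' t) t)
    (hS' : ContinuousOn S' (Prod.fst '' Ω)) {C : ℝ} (hC : ∀ t ∈ Prod.fst '' Ω, |S t| ≤ C)
    (hu : ContDiff ℝ 1 u) (huc : HasCompactSupport u) (hsub : tsupport u ⊆ Ω) (hu0 : ∀ p, 0 ≤ u p)
    {c θ : ℝ} (hc : 0 ≤ c)
    (hθ : ∀ t ∈ Prod.fst '' Ω, θ ≤ m * (volume.real (Prod.mk (T t) ⁻¹' K) /
      volume.real (Prod.mk t ⁻¹' Ω)) ^ (1 / (m : ℝ)) + S' t) :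
    2 * c * θ * ∫ p, u p ≤
      (∫ p, (fderiv ℝ u p (1, 0) ^ 2 + ∑ i, fderiv ℝ u p (0, Pi.single i 1) ^ 2)) +
      c ^ 2 * (volume.real Ω / volume.real K * (∫ p in K, ∑ i, p.2 i ^ 2) +
        ∫ t in Prod.fst '' Ω, S t ^ 2 * volume.real (Prod.mk t ⁻¹' Ω)) := by
  have hd : ∀ v, Integrable fun p => fderiv ℝ u p v ^ 2 := fun v =>
    ((continuous_fderiv_apply_of_contDiff hu v).pow 2).integrable_of_hasCompactSupport
      (hasCompactSupport_sq (hasCompactSupport_fderiv_apply huc v))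
  have hD : Integrable fun p => ∑ i : Fin m, fderiv ℝ u p (0, Pi.single i 1) ^ 2 :=
    integrable_finsetSum _ fun i _ => hd _
  have hN : IntegrableOn (fun p : ℝ × (Fin m → ℝ) => ∑ i, p.2 i ^ 2) K :=
    (Continuous.continuousOn (by fun_prop)).integrableOn_compact
      hK.isBounded.isCompact_closure |>.mono_set subset_closure
  rw [integral_add (hd _) hD, add_comm (∫ p, fderiv ℝ u p (1, 0) ^ 2)]
  refine integral_le_of_slices hΩ hK hT.injOn hT.image hT.hasDerivAt hS hS' hC hu huc hsub hu0 hc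
    hD (fun p => Finset.sum_nonneg fun i _ => sq_nonneg _) (N := fun y => ∑ i, y i ^ 2) hN
    (fun t ht => ?_) hθ
  have h := hm _ _ (hΩ.slice ht) (hK.slice (hT.mem ht)) (fun y => u (t, y))
    (hu.comp (contDiff_const.prodMk contDiff_id)) (hasCompactSupport_slice_right huc t)
    (fun y hy => hsub ?_) (fun y => hu0 _) c hc
  · simpa only [gradSq_slice hu] using h
  · have hcont : Continuous fun y : Fin m → ℝ => (t, y) := by fun_prop
    exact tsupport_comp_subset_preimage u hcont hy

end Step

section Cons

variable (m : ℕ)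

/-- The isomorphism `ℝ × ℝᵐ ≃ ℝᵐ⁺¹`. -/
abbrev consL : (ℝ × (Fin m → ℝ)) ≃L[ℝ] (Fin (m + 1) → ℝ) :=
  Fin.consEquivL ℝ fun _ : Fin (m + 1) => ℝ

theorem measurePreserving_consL : MeasurePreserving (consL m) := by
  have h := (volume_preserving_piFinSuccAbove (fun _ : Fin (m + 1) => ℝ) 0).symm
  convert h using 1
  ext p i
  simp [MeasurableEquiv.piFinSuccAbove]

theorem measurableEmbedding_consL : MeasurableEmbedding (consL m) :=
  (consL m).toHomeomorph.measurableEmbedding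

theorem consL_one_zero : consL m (1, 0) = Pi.single 0 1 := by
  ext i
  refine Fin.cases ?_ (fun i => ?_) i <;> simp

theorem consL_zero_single (i : Fin m) : consL m (0, Pi.single i 1) = Pi.single i.succ 1 := by
  ext j
  refine Fin.cases ?_ (fun j => ?_) j
  · simp
  · simp [Pi.single_apply]

end Cons

theorem IsConvexDomain.preimage {E F : Type*} [NormedAddCommGroup E] [NormedSpace ℝ E]
    [NormedAddCommGroup F] [NormedSpace ℝ F] {Ω : Set F} (h : IsConvexDomain Ω) (e : E ≃L[ℝ] F) :
    IsConvexDomain (e ⁻¹' Ω) where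
  nonempty := h.nonempty.preimage e.surjective
  isOpen := h.isOpen.preimage e.continuous
  isBounded := by
    rw [← ContinuousLinearEquiv.image_symm_eq_preimage]
    exact (e.symm : F →L[ℝ] E).lipschitz.isBounded_image h.isBounded
  convex := h.convex.is_linear_preimage e.toLinearMap.isLinear

theorem gradSq_consL {m : ℕ} (u : (Fin (m + 1) → ℝ) → ℝ) (p : ℝ × (Fin m → ℝ)) :
    gradSq u (consL m p) = fderiv ℝ (u ∘ consL m) p (1, 0) ^ 2 +
      ∑ i, fderiv ℝ (u ∘ consL m) p (0, Pi.single i 1) ^ 2 := by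
  rw [gradSq, Fin.sum_univ_succ, ContinuousLinearEquiv.comp_right_fderiv]
  simp [← consL_one_zero, ← consL_zero_single]

theorem tsupport_comp_subset {E F : Type*} [NormedAddCommGroup E] [NormedSpace ℝ E]
    [NormedAddCommGroup F] [NormedSpace ℝ F] {Ω : Set F} {u : F → ℝ} (e : E ≃L[ℝ] F)
    (h : tsupport u ⊆ Ω) : tsupport (u ∘ e) ⊆ e ⁻¹' Ω :=
  fun _ hx => h (tsupport_comp_subset_preimage u e.continuous hx)

section StepCons

variable {m : ℕ} {Ω K : Set (Fin (m + 1) → ℝ)}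

theorem volume_real_preimage_consL (hΩ : IsConvexDomain Ω) :
    volume.real (consL m ⁻¹' Ω) = volume.real Ω :=
  (measurePreserving_consL m).measureReal_preimage hΩ.isOpen.measurableSet.nullMeasurableSet

theorem setIntegral_preimage_consL (s : Set (Fin (m + 1) → ℝ)) (f : (Fin (m + 1) → ℝ) → ℝ) :
    ∫ p in consL m ⁻¹' s, f (consL m p) = ∫ x in s, f x :=
  (measurePreserving_consL m).setIntegral_preimage_emb (measurableEmbedding_consL m) f s

theorem integral_comp_consL (f : (Fin (m + 1) → ℝ) → ℝ) :
    ∫ p, f (consL m p) = ∫ x, f x :=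
  (measurePreserving_consL m).integral_comp (measurableEmbedding_consL m) f

theorem EnergyInequality.step_cons (hm : EnergyInequality m) (hΩ : IsConvexDomain Ω)
    (hK : IsConvexDomain K) {S S' T : ℝ → ℝ}
    (hT : IsFirstTransport (consL m ⁻¹' Ω) (consL m ⁻¹' K) T)
    (hS : ∀ t ∈ Prod.fst '' (consL m ⁻¹' Ω), HasDerivAt S (S' t) t)
    (hS' : ContinuousOn S' (Prod.fst '' (consL m ⁻¹' Ω))) {C : ℝ}
    (hC : ∀ t ∈ Prod.fst '' (consL m ⁻¹' Ω), |S t| ≤ C) {u : (Fin (m + 1) → ℝ) → ℝ}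
    (hu : ContDiff ℝ 1 u) (huc : HasCompactSupport u) (hsub : tsupport u ⊆ Ω)
    (hu0 : ∀ p, 0 ≤ u p) {c θ : ℝ} (hc : 0 ≤ c)
    (hθ : ∀ t ∈ Prod.fst '' (consL m ⁻¹' Ω),
      θ ≤ m * (volume.real (Prod.mk (T t) ⁻¹' (consL m ⁻¹' K)) /
        volume.real (Prod.mk t ⁻¹' (consL m ⁻¹' Ω))) ^ (1 / (m : ℝ)) + S' t) :
    2 * c * θ * ∫ x, u x ≤ (∫ x, gradSq u x) +
      c ^ 2 * (volume.real Ω / volume.real K * (∫ y in K, ∑ i : Fin m, y i.succ ^ 2) +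
        ∫ t in Prod.fst '' (consL m ⁻¹' Ω),
          S t ^ 2 * volume.real (Prod.mk t ⁻¹' (consL m ⁻¹' Ω))) := by
  have h := hm.step (hΩ.preimage (consL m)) (hK.preimage (consL m)) hT hS hS' hC
    (hu.comp (consL m).contDiff) (huc.comp_homeomorph (consL m).toHomeomorph)
    (tsupport_comp_subset (consL m) hsub) (fun p => hu0 _) hc hθ
  simp only [← gradSq_consL] at h
  rw [volume_real_preimage_consL hΩ, volume_real_preimage_consL hK,
    integral_comp_consL (gradSq u)] at h
  have e1 : ∫ p, (u ∘ consL m) p = ∫ x, u x := integral_comp_consL u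
  have e2 : ∫ p in consL m ⁻¹' K, ∑ i, p.2 i ^ 2 = ∫ y in K, ∑ i : Fin m, y i.succ ^ 2 :=
    setIntegral_preimage_consL K fun y => ∑ i : Fin m, y i.succ ^ 2
  rwa [e1, e2] at h

theorem IsFirstTransport.integral_comp_cons (hΩ : IsConvexDomain Ω) (hK : IsConvexDomain K)
    {T : ℝ → ℝ} (h : IsFirstTransport (consL m ⁻¹' Ω) (consL m ⁻¹' K) T) {g : ℝ → ℝ}
    (hg : Continuous g) :
    ∫ t in Prod.fst '' (consL m ⁻¹' Ω), g (T t) * volume.real (Prod.mk t ⁻¹' (consL m ⁻¹' Ω)) =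
      volume.real Ω / volume.real K * ∫ y in K, g (y 0) := by
  rw [h.integral_comp (hΩ.preimage _) (hK.preimage _) hg, volume_real_preimage_consL hΩ,
    volume_real_preimage_consL hK]
  congr 1
  exact setIntegral_preimage_consL K fun y => g (y 0)

theorem IsConvexDomain.setIntegral_sum_sq (hK : IsConvexDomain K) :
    ∫ y in K, ∑ i, y i ^ 2 = (∫ y in K, y 0 ^ 2) + ∫ y in K, ∑ i : Fin m, y i.succ ^ 2 := by
  simp only [Fin.sum_univ_succ]
  refine integral_add ?_ ?_ <;>
  exact (Continuous.continuousOn (by fun_prop)).integrableOn_compact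
      hK.isBounded.isCompact_closure |>.mono_set subset_closure

end StepCons

theorem volume_real_eq_one_of_nonempty {s : Set (Fin 0 → ℝ)} (h : s.Nonempty) :
    volume.real s = 1 := by
  rw [Subsingleton.eq_univ_of_nonempty h]
  simp [measureReal_def, volume_pi]

theorem energyInequality (n : ℕ) : EnergyInequality n := by
  induction n with
  | zero =>
    intro Ω K hΩ hK u hu huc hsub hu0 c hc
    have h1 : 0 ≤ ∫ x, gradSq u x := integral_nonneg fun x => by simp [gradSq]
    simpa using h1
  | succ m hm =>
    intro Ω K hΩ hK u hu huc hsub hu0 c hc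
    have hΩ' := hΩ.preimage (consL m)
    have hK' := hK.preimage (consL m)
    obtain ⟨T, hT⟩ := exists_isFirstTransport hΩ' hK'
    obtain ⟨C, hC⟩ := hT.exists_bound hK'
    have h := hm.step_cons hΩ hK hT hT.hasDerivAt (hT.continuousOn_deriv hΩ' hK') hC hu huc hsub
      hu0 hc (θ := ((m + 1 : ℕ) : ℝ) * (volume.real K / volume.real Ω) ^ (1 / ((m + 1 : ℕ) : ℝ)))
      (fun t ht => ?_)
    · rw [hT.integral_comp_cons hΩ hK (continuous_pow 2), ← mul_add, add_comm (∫ y in K, _),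
        ← hK.setIntegral_sum_sq] at h
      exact h
    · have hA := (hΩ'.slice ht).measureReal_pos
      have hB := (hK'.slice (hT.mem ht)).measureReal_pos
      have hv := hΩ.measureReal_pos
      have hw := hK.measureReal_pos
      refine (nat_mul_rpow_add_ge (div_pos hB hA) (div_pos hw hv) fun h0 => ?_).trans_eq ?_
      · subst h0
        rw [volume_real_eq_one_of_nonempty (hΩ'.slice ht).nonempty,
          volume_real_eq_one_of_nonempty (hK'.slice (hT.mem ht)).nonempty, div_one]
      · rw [volume_real_preimage_consL hΩ, volume_real_preimage_consL hK]
        field_simp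

/-- A transport map can be perturbed where there is slack `h > 0` so as to strictly decrease its
second moment. -/
theorem exists_perturbation {I : Set ℝ} (hI : IsOpen I) {T τ A h : ℝ → ℝ}
    (hT : ∀ t ∈ I, HasDerivAt T (τ t) t) (hτ : ContinuousOn τ I) (hτ0 : ∀ t ∈ I, τ t ≠ 0)
    (hA : ContinuousOn A I) (hA0 : ∀ t ∈ I, 0 < A t) (hAi : IntegrableOn A I) {C : ℝ}
    (hC : ∀ t ∈ I, |T t| ≤ C) (hh : ContinuousOn h I) (hh0 : ∀ t ∈ I, 0 ≤ h t)
    {t₀ : ℝ} (ht₀ : t₀ ∈ I) (hht₀ : 0 < h t₀) :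
    ∃ S S' : ℝ → ℝ, (∀ t ∈ I, HasDerivAt S (S' t) t) ∧ ContinuousOn S' I ∧
      (∀ t ∈ I, |S t| ≤ C) ∧ (∀ t ∈ I, τ t ≤ S' t + h t) ∧
      ∫ t in I, S t ^ 2 * A t < ∫ t in I, T t ^ 2 * A t := by
  have hTc : ContinuousOn T I := fun t ht => (hT t ht).continuousAt.continuousWithinAt
  have hU : IsOpen (I ∩ h ⁻¹' Ioi 0) := hh.isOpen_inter_preimage hI isOpen_Ioi
  have hW : IsOpen (I ∩ h ⁻¹' Ioi 0 ∩ (I ∩ T ⁻¹' {0}ᶜ)) :=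
    hU.inter (hTc.isOpen_inter_preimage hI isOpen_compl_singleton)
  obtain ⟨t₁, ht₁, ht₁'⟩ := (((hT t₀ ht₀).eventually_ne (hτ0 t₀ ht₀) (c := 0)).and
    (mem_nhdsWithin_of_mem_nhds (hU.mem_nhds ⟨ht₀, hht₀⟩))).exists
  obtain ⟨ψ, hψW, hψc, hψs, hψr, hψ1⟩ := exists_contDiff_tsupport_subset (n := 1)
    (hW.mem_nhds ⟨ht₁', ht₁'.1, ht₁⟩)
  have hψ0 : ∀ t, 0 ≤ ψ t := fun t => (hψr (mem_range_self t)).1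
  have hψ2 : ∀ t, ψ t ≤ 1 := fun t => (hψr (mem_range_self t)).2
  have hψI : tsupport ψ ⊆ I := fun t ht => (hψW ht).1.1
  have hψd : ∀ t, HasDerivAt ψ (deriv ψ t) t := fun t =>
    (hψs.differentiable one_ne_zero t).hasDerivAt
  have hψd' : Continuous (deriv ψ) := hψs.continuous_deriv le_rfl
  obtain ⟨M, hM⟩ := hψc.isCompact.exists_bound_of_continuousOn
    (f := fun t => (τ t * ψ t + T t * deriv ψ t) / h t)
    ((((hτ.mul hψs.continuous.continuousOn).add (hTc.mul hψd'.continuousOn)).mono hψI).div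
      (hh.mono hψI) fun t ht => (hψW ht).1.2.ne')
  set δ : ℝ := 1 / (|M| + 1) with hδ
  have hδ0 : 0 < δ := by positivity
  have hδ1 : δ ≤ 1 := by
    rw [hδ, div_le_one (by positivity)]
    linarith [abs_nonneg M]
  have hδM : δ * |M| ≤ 1 := by
    rw [hδ, one_div_mul_eq_div, div_le_one (by positivity)]
    linarith
  refine ⟨fun t => T t * (1 - δ * ψ t),
    fun t => τ t * (1 - δ * ψ t) + T t * -(δ * deriv ψ t), fun t ht => ?_, ?_, fun t ht => ?_,
    fun t ht => ?_, ?_⟩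
  · exact (hT t ht).mul (((hψd t).const_mul δ).const_sub 1)
  · have := hψs.continuous.continuousOn (s := I)
    have := hψd'.continuousOn (s := I)
    fun_prop
  · rw [abs_mul]
    have h1 : |1 - δ * ψ t| ≤ 1 := by
      have := mul_nonneg hδ0.le (hψ0 t)
      have := mul_le_one₀ hδ1 (hψ0 t) (hψ2 t)
      rw [abs_le]
      constructor <;> linarith
    exact (mul_le_of_le_one_right (abs_nonneg _) h1).trans (hC t ht)
  · have key : δ * (τ t * ψ t + T t * deriv ψ t) ≤ h t := by
      by_cases hts : t ∈ tsupport ψ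
      · have hp : 0 < h t := (hψW hts).1.2
        have h1 : τ t * ψ t + T t * deriv ψ t ≤ |M| * h t := by
          rw [← div_le_iff₀ hp]
          exact (le_abs_self _).trans ((hM t hts).trans (le_abs_self M))
        calc δ * (τ t * ψ t + T t * deriv ψ t) ≤ δ * (|M| * h t) := by gcongr
          _ = δ * |M| * h t := by ring
          _ ≤ h t := mul_le_of_le_one_left hp.le hδM
      · rw [image_eq_zero_of_notMem_tsupport hts, image_eq_zero_of_notMem_tsupport
          fun h => hts (tsupport_deriv_subset h)]
        simpa using hh0 t ht
    linarith
  · have hφs : tsupport (fun t => ψ t * (δ * (2 - δ * ψ t))) ⊆ tsupport ψ :=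
      tsupport_mul_subset_left
    have hG : Continuous fun t => T t ^ 2 * A t * (ψ t * (δ * (2 - δ * ψ t))) :=
      continuous_mul_of_tsupport (S := fun t => T t ^ 2 * A t) (g := id) hI
        ((hTc.pow 2).mul hA) continuous_id (by have := hψs.continuous; fun_prop)
        fun t ht => hψI (hφs ht)
    have hGc : HasCompactSupport fun t => T t ^ 2 * A t * (ψ t * (δ * (2 - δ * ψ t))) :=
      hψc.mul_right.mul_left
    have hGI : ∀ t ∉ I, T t ^ 2 * A t * (ψ t * (δ * (2 - δ * ψ t))) = 0 := fun t ht => by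
      simp [image_eq_zero_of_notMem_tsupport fun h => ht (hψI h)]
    have hw : ∀ t, 0 < 2 - δ * ψ t := fun t => by
      linarith [mul_le_one₀ hδ1 (hψ0 t) (hψ2 t)]
    have hGpos : 0 < ∫ t, T t ^ 2 * A t * (ψ t * (δ * (2 - δ * ψ t))) := by
      refine hG.integral_pos_of_hasCompactSupport_nonneg_nonzero (x := t₁) hGc (fun t => ?_) ?_
      · by_cases ht : t ∈ I
        · have := (hA0 t ht).le
          have := (hw t).le
          have := hψ0 t
          simp only [Pi.zero_apply]
          positivity
        · exact (hGI t ht).ge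
      · have h1 := hw t₁
        have h2 := hA0 t₁ ht₁'.1
        have h3 : T t₁ ≠ 0 := ht₁
        rw [hψ1] at h1 ⊢
        positivity
    rw [← setIntegral_eq_integral_of_forall_compl_eq_zero hGI] at hGpos
    have hTA : IntegrableOn (fun t => T t ^ 2 * A t) I := by
      refine Integrable.bdd_mul (c := C ^ 2) hAi
        ((hTc.pow 2).aestronglyMeasurable hI.measurableSet) ?_
      filter_upwards [ae_restrict_mem hI.measurableSet] with t ht
      rw [norm_pow]
      exact pow_le_pow_left₀ (norm_nonneg _) (hC t ht) 2
    have e : ∫ t in I, (T t * (1 - δ * ψ t)) ^ 2 * A t = (∫ t in I, T t ^ 2 * A t) -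
        ∫ t in I, T t ^ 2 * A t * (ψ t * (δ * (2 - δ * ψ t))) := by
      rw [← integral_sub hTA (hG.integrable_of_hasCompactSupport hGc).integrableOn]
      congr 1
      ext t
      ring
    rw [e]
    linarith

section Rigidity

variable {m : ℕ} {Ω K : Set (Fin (m + 1) → ℝ)}

theorem setIntegral_eval_eq_zero_of_neg {n : ℕ} {K : Set (Fin n → ℝ)} (hK : ∀ y ∈ K, -y ∈ K)
    (i : Fin n) : ∫ y in K, y i = 0 := by
  have h := (Measure.measurePreserving_neg (volume : Measure (Fin n → ℝ))).setIntegral_preimage_emb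
    (Homeomorph.neg _).measurableEmbedding (fun y => y i) K
  have e : Neg.neg ⁻¹' K = K := by
    ext y
    exact ⟨fun hy => neg_neg y ▸ hK _ hy, fun hy => hK y hy⟩
  rw [e] at h
  simp only [Pi.neg_apply, integral_neg] at h
  linarith

/-- Either the energy inequality has a deficit, or the projection of `Ω` to the first coordinate,
relative to the centroid, is contained in that of `K`. -/
theorem exists_deficit_or_mem_image (hm : 0 < m) (hΩ : IsConvexDomain Ω) (hK : IsConvexDomain K)
    (hvol : volume.real Ω = volume.real K) (hneg : ∀ y ∈ K, -y ∈ K) :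
    (∃ ε, 0 < ε ∧ ∀ u : (Fin (m + 1) → ℝ) → ℝ, ContDiff ℝ 1 u → HasCompactSupport u →
      tsupport u ⊆ Ω → (∀ x, 0 ≤ u x) → ∀ c : ℝ, 0 ≤ c →
      2 * c * (m + 1 : ℕ) * ∫ x, u x ≤ (∫ x, gradSq u x) +
        c ^ 2 * ((∫ y in K, ∑ i, y i ^ 2) - ε)) ∨
    ∀ x ∈ Ω, ∃ y ∈ K, y 0 = x 0 - (volume.real Ω)⁻¹ * ∫ z in Ω, z 0 := by
  have hΩ' := hΩ.preimage (consL m)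
  have hK' := hK.preimage (consL m)
  have hv := hΩ.measureReal_pos
  obtain ⟨T, hT⟩ := exists_isFirstTransport hΩ' hK'
  obtain ⟨C, hC⟩ := hT.exists_bound hK'
  set I := Prod.fst '' (consL m ⁻¹' Ω) with hIdef
  set A : ℝ → ℝ := fun t => volume.real (Prod.mk t ⁻¹' (consL m ⁻¹' Ω)) with hAdef
  set B : ℝ → ℝ := fun t => volume.real (Prod.mk (T t) ⁻¹' (consL m ⁻¹' K)) with hBdef
  have hA : ∀ t ∈ I, 0 < A t := fun t ht => (hΩ'.slice ht).measureReal_pos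
  have hB : ∀ t ∈ I, 0 < B t := fun t ht => (hK'.slice (hT.mem ht)).measureReal_pos
  have hAc : ContinuousOn A I := hΩ'.continuousOn_volume_slice
  have hBc : ContinuousOn B I := hK'.continuousOn_volume_slice.comp hT.continuousOn
    fun t ht => hT.mem ht
  have hτ : ∀ t ∈ I, HasDerivAt T (1 / (B t / A t)) t := fun t ht => by
    have h := hT.hasDerivAt t ht
    rw [volume_real_preimage_consL hΩ, volume_real_preimage_consL hK, hvol,
      div_self (hvol ▸ hv).ne', one_mul] at h
    rwa [one_div_div]
  have hβc : ContinuousOn (fun t => B t / A t) I := hBc.div hAc fun t ht => (hA t ht).ne'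
  have hβ0 : ∀ t ∈ I, 0 < B t / A t := fun t ht => div_pos (hB t ht) (hA t ht)
  have hτc : ContinuousOn (fun t => 1 / (B t / A t)) I :=
    continuousOn_const.div hβc fun t ht => (hβ0 t ht).ne'
  have hI := hΩ'.image_fst
  by_cases hβ : ∀ t ∈ I, B t / A t = 1
  · right
    obtain ⟨k, hk⟩ := hI.isOpen.exists_is_const_of_deriv_eq_zero (f := fun t => T t - t)
      hI.convex.isPreconnected
      (fun t ht => ((hτ t ht).sub (hasDerivAt_id t)).differentiableAt.differentiableWithinAt)
      (fun t ht => by 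
        have h := ((hτ t ht).sub (hasDerivAt_id t)).deriv
        rw [hβ t ht, div_one, sub_self] at h
        exact h)
    have hk' : ∀ t ∈ I, T t = t + k := fun t ht => by linarith [hk t ht]
    have h1 := hT.integral_comp_cons hΩ hK (g := fun s => s - k) (by fun_prop)
    have hKint : IntegrableOn (fun y : Fin (m + 1) → ℝ => y 0) K :=
      (Continuous.continuousOn (by fun_prop)).integrableOn_compact
        hK.isBounded.isCompact_closure |>.mono_set subset_closure
    have hKc : IntegrableOn (fun y : Fin (m + 1) → ℝ => k) K :=
      integrableOn_const hK.measure_lt_top.ne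
    have hΩint : IntegrableOn (fun p : ℝ × (Fin m → ℝ) => p.1) (consL m ⁻¹' Ω) :=
      (Continuous.continuousOn (by fun_prop)).integrableOn_compact
        hΩ'.isBounded.isCompact_closure |>.mono_set subset_closure
    have h2 := hΩ'.setIntegral_eq_slice hΩint
    have h3 : ∫ p in consL m ⁻¹' Ω, p.1 = ∫ z in Ω, z 0 :=
      setIntegral_preimage_consL Ω fun y => y 0
    have h4 : ∫ t in I, (T t - k) * A t = ∫ t in I, ∫ y in Prod.mk t ⁻¹' (consL m ⁻¹' Ω), t := by
      refine setIntegral_congr_fun hI.isOpen.measurableSet fun t ht => ?_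
      simp [hk' t ht, hAdef, mul_comm]
    rw [integral_sub hKint hKc, setIntegral_eval_eq_zero_of_neg hneg, setIntegral_const, h4,
      ← h2, h3, hvol, div_self (hvol ▸ hv).ne'] at h1
    intro x hx
    have hx' : x 0 ∈ I := ⟨(consL m).symm x, by
      rwa [mem_preimage, ContinuousLinearEquiv.apply_symm_apply], rfl⟩
    obtain ⟨p, hp, hpx⟩ := hT.mem hx'
    refine ⟨consL m p, hp, ?_⟩
    rw [h1, ← hvol]
    change p.1 = _
    rw [hpx, hk' _ hx']
    simp
    field_simp
  · left
    push Not at hβ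
    obtain ⟨t₀, ht₀, hβ1⟩ := hβ
    have hsum : ContinuousOn (fun t => m * (B t / A t) ^ (1 / (m : ℝ)) + 1 / (B t / A t) -
        (m + 1 : ℕ)) I :=
      ((continuousOn_const.mul (hβc.rpow_const fun t ht => Or.inl (hβ0 t ht).ne')).add hτc).sub
        continuousOn_const
    obtain ⟨S, S', hS, hS', hSC, hSS, hlt⟩ := exists_perturbation hI.isOpen hτ hτc
      (fun t ht => (one_div_pos.2 (hβ0 t ht)).ne') hAc hA hΩ'.integrableOn_volume_slice hC hsum
      (fun t ht => by
        have := nat_mul_rpow_add_ge (hβ0 t ht) one_pos fun h => absurd h hm.ne'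
        simp only [Real.one_rpow, mul_one] at this
        linarith) ht₀ (sub_pos.2 (nat_mul_rpow_add_gt hm (hβ0 t₀ ht₀) hβ1))
    refine ⟨_, sub_pos.2 hlt, fun u hu huc hsub hu0 c hc => ?_⟩
    have h := (energyInequality m).step_cons hΩ hK hT hS hS' hSC hu huc hsub hu0 hc
      (θ := ((m + 1 : ℕ) : ℝ)) (fun t ht => by
        have := hSS t ht
        simp only [hAdef, hBdef] at this
        linarith)
    have h2 := hT.integral_comp_cons hΩ hK (continuous_pow 2)
    rw [hvol, div_self (hvol ▸ hv).ne', one_mul] at h h2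
    refine h.trans_eq ?_
    rw [hK.setIntegral_sum_sq, h2]
    ring

end Rigidity

section Coordinates

variable {n : ℕ} (b : OrthonormalBasis (Fin n) ℝ (EuclideanSpace ℝ (Fin n)))

/-- The coordinates given by an orthonormal basis. -/
def coordL : (Fin n → ℝ) ≃L[ℝ] EuclideanSpace ℝ (Fin n) :=
  (EuclideanSpace.equiv (Fin n) ℝ).symm.trans b.repr.symm.toContinuousLinearEquiv

theorem coordL_apply (y : Fin n → ℝ) : coordL b y = b.repr.symm (WithLp.toLp 2 y) := rfl

theorem measurePreserving_coordL : MeasurePreserving (coordL b) :=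
  b.measurePreserving_repr_symm.comp (PiLp.volume_preserving_toLp (Fin n))

theorem measurableEmbedding_coordL : MeasurableEmbedding (coordL b) :=
  (coordL b).toHomeomorph.measurableEmbedding

theorem coordL_single (i : Fin n) : coordL b (Pi.single i 1) = b i := by
  rw [coordL_apply]
  exact b.repr_symm_single i

theorem inner_coordL (i : Fin n) (y : Fin n → ℝ) : inner ℝ (b i) (coordL b y) = y i := by
  rw [coordL_apply, ← b.repr_apply_apply, LinearIsometryEquiv.apply_symm_apply]

theorem norm_coordL_sq (y : Fin n → ℝ) : ‖coordL b y‖ ^ 2 = ∑ i, y i ^ 2 := by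
  rw [coordL_apply, LinearIsometryEquiv.norm_map, EuclideanSpace.real_norm_sq_eq]

theorem gradSq_comp_coordL (u : EuclideanSpace ℝ (Fin n) → ℝ) (y : Fin n → ℝ) :
    gradSq (u ∘ coordL b) y = ‖gradient u (coordL b y)‖ ^ 2 := by
  rw [gradSq, ← b.sum_sq_inner_left, ContinuousLinearEquiv.comp_right_fderiv]
  refine Finset.sum_congr rfl fun i _ => ?_
  simp [coordL_single, gradient]

theorem setIntegral_preimage_coordL (s : Set (EuclideanSpace ℝ (Fin n)))
    (f : EuclideanSpace ℝ (Fin n) → ℝ) :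
    ∫ y in coordL b ⁻¹' s, f (coordL b y) = ∫ x in s, f x :=
  (measurePreserving_coordL b).setIntegral_preimage_emb (measurableEmbedding_coordL b) f s

theorem integral_comp_coordL (f : EuclideanSpace ℝ (Fin n) → ℝ) :
    ∫ y, f (coordL b y) = ∫ x, f x :=
  (measurePreserving_coordL b).integral_comp (measurableEmbedding_coordL b) f

theorem volume_real_preimage_coordL {Ω : Set (EuclideanSpace ℝ (Fin n))} (hΩ : IsConvexDomain Ω) :
    volume.real (coordL b ⁻¹' Ω) = volume.real Ω :=
  (measurePreserving_coordL b).measureReal_preimage hΩ.isOpen.measurableSet.nullMeasurableSet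

end Coordinates

section Torsion

variable {n : ℕ} {Ω K : Set (EuclideanSpace ℝ (Fin n))}

/-- A bound on the torsion functional on nonnegative functions. -/
def TorsionBound (Ω : Set (EuclideanSpace ℝ (Fin n))) (M : ℝ) : Prop :=
  ∀ u : EuclideanSpace ℝ (Fin n) → ℝ, ContDiff ℝ 1 u → HasCompactSupport u → tsupport u ⊆ Ω →
    (∀ x, 0 ≤ u x) → 2 * ∫ x, u x ≤ (∫ x, ‖gradient u x‖ ^ 2) + M

theorem torsionBound_of_volume_eq (hn : 0 < n) (hΩ : IsConvexDomain Ω) (hK : IsConvexDomain K)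
    (hvol : volume.real Ω = volume.real K) :
    TorsionBound Ω ((1 / n) ^ 2 * ∫ y in K, ‖y‖ ^ 2) := by
  intro u hu huc hsub hu0
  set b := EuclideanSpace.basisFun (Fin n) ℝ
  have hn' : (0 : ℝ) < n := by exact_mod_cast hn
  have h := energyInequality n _ _ (hΩ.preimage (coordL b)) (hK.preimage (coordL b))
    (u ∘ coordL b) (hu.comp (coordL b).contDiff) (huc.comp_homeomorph (coordL b).toHomeomorph)
    (tsupport_comp_subset (coordL b) hsub) (fun p => hu0 _) (1 / n) (by positivity)
  rw [volume_real_preimage_coordL b hΩ, volume_real_preimage_coordL b hK, hvol,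
    div_self hK.measureReal_pos.ne', Real.one_rpow, one_mul, mul_one] at h
  simp only [gradSq_comp_coordL, ← norm_coordL_sq b, Function.comp_apply] at h
  rw [integral_comp_coordL b u, integral_comp_coordL b fun x => ‖gradient u x‖ ^ 2,
    setIntegral_preimage_coordL b K fun x => ‖x‖ ^ 2] at h
  field_simp at h ⊢
  exact h

theorem exists_deficit_or_inner (hn : 2 ≤ n)
    (b : OrthonormalBasis (Fin n) ℝ (EuclideanSpace ℝ (Fin n))) (i₀ : Fin n) (hi₀ : i₀.val = 0)
    (hΩ : IsConvexDomain Ω) (hK : IsConvexDomain K)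
    (hvol : volume.real Ω = volume.real K) (hneg : ∀ y ∈ K, -y ∈ K) :
    (∃ ε, 0 < ε ∧ TorsionBound Ω ((1 / n) ^ 2 * ((∫ y in K, ‖y‖ ^ 2) - ε))) ∨
    ∀ x ∈ Ω, ∃ y ∈ K, inner ℝ (b i₀) y =
      inner ℝ (b i₀) x - (volume.real Ω)⁻¹ * ∫ z in Ω, inner ℝ (b i₀) z := by
  obtain ⟨m, rfl⟩ : ∃ m, n = m + 1 := ⟨n - 1, by omega⟩
  obtain rfl : i₀ = 0 := Fin.ext hi₀
  rcases exists_deficit_or_mem_image (by omega) (hΩ.preimage (coordL b))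
    (hK.preimage (coordL b)) (by
      rw [volume_real_preimage_coordL b hΩ, volume_real_preimage_coordL b hK, hvol])
    (fun y hy => by
      rw [mem_preimage, map_neg]
      exact hneg _ hy) with ⟨ε, hε, h⟩ | h
  · refine Or.inl ⟨ε, hε, fun u hu huc hsub hu0 => ?_⟩
    have h := h (u ∘ coordL b) (hu.comp (coordL b).contDiff)
      (huc.comp_homeomorph (coordL b).toHomeomorph) (tsupport_comp_subset (coordL b) hsub)
      (fun p => hu0 _) (1 / (m + 1 : ℕ)) (by positivity)
    simp only [gradSq_comp_coordL, ← norm_coordL_sq b, Function.comp_apply] at h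
    rw [integral_comp_coordL b u, integral_comp_coordL b fun x => ‖gradient u x‖ ^ 2,
      setIntegral_preimage_coordL b K fun x => ‖x‖ ^ 2] at h
    have hm : ((m + 1 : ℕ) : ℝ) ≠ 0 := by positivity
    rwa [mul_assoc 2, one_div_mul_cancel hm, mul_one] at h
  · refine Or.inr fun x hx => ?_
    obtain ⟨y, hy, hyx⟩ := h ((coordL b).symm x) (by
      rwa [mem_preimage, ContinuousLinearEquiv.apply_symm_apply])
    refine ⟨coordL b y, hy, ?_⟩
    have e := setIntegral_preimage_coordL b Ω fun z => inner ℝ (b 0) z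
    simp only [inner_coordL] at e
    rw [inner_coordL, hyx, e, volume_real_preimage_coordL b hΩ,
      ← inner_coordL b 0 ((coordL b).symm x), ContinuousLinearEquiv.apply_symm_apply]

theorem integrable_norm_gradient_sq {u : EuclideanSpace ℝ (Fin n) → ℝ} (hu : ContDiff ℝ 1 u)
    (huc : HasCompactSupport u) : Integrable fun x => ‖gradient u x‖ ^ 2 := by
  simp only [gradient, LinearIsometryEquiv.norm_map]
  exact ((hu.continuous_fderiv one_ne_zero).norm.pow 2).integrable_of_hasCompactSupport
    (hasCompactSupport_sq (huc.fderiv (𝕜 := ℝ)).norm)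

theorem setIntegral_norm_gradient_sq {u : EuclideanSpace ℝ (Fin n) → ℝ} (hsub : tsupport u ⊆ Ω) :
    ∫ x in Ω, ‖gradient u x‖ ^ 2 = ∫ x, ‖gradient u x‖ ^ 2 :=
  setIntegral_eq_integral_of_forall_compl_eq_zero fun x hx => by
    simp [gradient, fderiv_of_notMem_tsupport (𝕜 := ℝ) fun h => hx (hsub h)]

theorem setIntegral_of_tsupport {u : EuclideanSpace ℝ (Fin n) → ℝ} (hsub : tsupport u ⊆ Ω) :
    ∫ x in Ω, u x = ∫ x, u x :=
  setIntegral_eq_integral_of_forall_compl_eq_zero fun _ hx =>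
    image_eq_zero_of_notMem_tsupport fun h => hx (hsub h)

theorem TorsionBound.le (hΩ : IsConvexDomain Ω) {M : ℝ} (hM : TorsionBound Ω M)
    {u : EuclideanSpace ℝ (Fin n) → ℝ} (hu : ContDiff ℝ 1 u) (huc : HasCompactSupport u)
    (hsub : tsupport u ⊆ Ω) : 2 * (∫ x in Ω, u x) - ∫ x in Ω, ‖gradient u x‖ ^ 2 ≤ M := by
  have hv := hΩ.measureReal_pos
  refine le_of_forall_pos_le_add fun η hη => ?_
  set ε := η / (2 * volume.real Ω) with hε
  have hε0 : 0 < ε := by positivity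
  have hpos : ∀ x, 0 < u x ^ 2 + ε ^ 2 := fun x => by positivity
  set φ : EuclideanSpace ℝ (Fin n) → ℝ := fun x => √(u x ^ 2 + ε ^ 2) - ε with hφ
  have hφs : Function.support φ ⊆ Function.support u := by
    intro x hx hx0
    apply hx
    simp [hφ, hx0, Real.sqrt_sq hε0.le]
  have hφ0 : ∀ x, 0 ≤ φ x := fun x => sub_nonneg.2 (Real.le_sqrt_of_sq_le (by nlinarith))
  have hφu : ∀ x, u x ≤ φ x + ε := fun x => by
    simp only [hφ, sub_add_cancel]
    exact Real.le_sqrt_of_sq_le (by nlinarith)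
  have hφd : ContDiff ℝ 1 φ :=
    (((hu.pow 2).add contDiff_const).sqrt fun x => (hpos x).ne').sub contDiff_const
  have hφc : HasCompactSupport φ := huc.mono hφs
  have hφsub : tsupport φ ⊆ Ω := (closure_mono hφs).trans hsub
  have hgrad : ∀ x, ‖gradient φ x‖ ^ 2 ≤ ‖gradient u x‖ ^ 2 := by
    intro x
    simp only [gradient, LinearIsometryEquiv.norm_map]
    have h1 := ((((hu.differentiable one_ne_zero x).hasFDerivAt.pow 2).add_const (ε ^ 2)).sqrt
      (hpos x).ne').sub_const ε
    have h2 : fderiv ℝ φ x = (u x / √(u x ^ 2 + ε ^ 2)) • fderiv ℝ u x := by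
      rw [h1.fderiv, smul_smul]
      congr 1
      have := Real.sqrt_pos.2 (hpos x)
      field_simp
      simp
    rw [h2, norm_smul]
    have h3 : ‖u x / √(u x ^ 2 + ε ^ 2)‖ ≤ 1 := by
      rw [norm_div, Real.norm_of_nonneg (Real.sqrt_nonneg _)]
      refine div_le_one_of_le₀ (Real.le_sqrt_of_sq_le ?_) (Real.sqrt_nonneg _)
      rw [Real.norm_eq_abs, sq_abs]
      nlinarith
    gcongr
    exact mul_le_of_le_one_left (norm_nonneg _) h3
  have h1 := hM φ hφd hφc hφsub hφ0
  have h2 : ∫ x in Ω, u x ≤ ∫ x in Ω, (φ x + ε) :=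
    setIntegral_mono (hu.continuous.integrable_of_hasCompactSupport huc).integrableOn
      ((hφd.continuous.integrable_of_hasCompactSupport hφc).integrableOn.add
        (integrableOn_const hΩ.measure_lt_top.ne)) hφu
  rw [integral_add (hφd.continuous.integrable_of_hasCompactSupport hφc).integrableOn
    (integrableOn_const hΩ.measure_lt_top.ne), setIntegral_const, smul_eq_mul,
    setIntegral_of_tsupport hφsub] at h2
  have h3 := integral_mono (integrable_norm_gradient_sq hφd hφc)
    (integrable_norm_gradient_sq hu huc) hgrad
  rw [setIntegral_norm_gradient_sq hsub]
  have h4 : volume.real Ω * ε = η / 2 := by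
    rw [hε]
    field_simp
  linarith

/-- The values over which `torsionalRigidityN` takes the supremum. -/
def torsionValues (Ω : Set (EuclideanSpace ℝ (Fin n))) : Set ℝ :=
  {v : ℝ | ∃ u : EuclideanSpace ℝ (Fin n) → ℝ, ContDiff ℝ (⊤ : ℕ∞) u ∧
    HasCompactSupport u ∧ tsupport u ⊆ Ω ∧
    v = 2 * (∫ x in Ω, u x) - ∫ x in Ω, ‖gradient u x‖ ^ 2}

theorem TorsionBound.mem_upperBounds (hΩ : IsConvexDomain Ω) {M : ℝ} (hM : TorsionBound Ω M) :
    M ∈ upperBounds (torsionValues Ω) := by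
  rintro v ⟨u, hu, huc, hsub, rfl⟩
  exact hM.le hΩ (hu.of_le (by exact_mod_cast le_top)) huc hsub

theorem torsionValues_nonempty : (torsionValues Ω).Nonempty :=
  ⟨_, 0, contDiff_const, HasCompactSupport.zero, by simp, rfl⟩

theorem TorsionBound.torsionalRigidityN_le (hΩ : IsConvexDomain Ω) {M : ℝ}
    (hM : TorsionBound Ω M) : torsionalRigidityN n Ω ≤ M :=
  csSup_le torsionValues_nonempty (hM.mem_upperBounds hΩ)

end Torsion

theorem exists_smooth_approx_id {ε : ℝ} (hε : 0 < ε) :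
    ∃ ψ : ℝ → ℝ, ContDiff ℝ (⊤ : ℕ∞) ψ ∧ (∀ s ≤ ε, ψ s = 0) ∧ (∀ s, |deriv ψ s| ≤ 1) ∧
      ∀ s, s - 2 * ε ≤ ψ s := by
  set σ : ℝ → ℝ := fun t => Real.smoothTransition (t / ε - 1) with hσ
  have hσs : ContDiff ℝ (⊤ : ℕ∞) σ :=
    Real.smoothTransition.contDiff.comp ((contDiff_id.div_const ε).sub contDiff_const)
  have hσc : Continuous σ := hσs.continuous
  have hσi : ∀ a b, IntervalIntegrable σ volume a b := fun a b => hσc.intervalIntegrable a b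
  have hd : ∀ s, HasDerivAt (fun s => ∫ t in (0 : ℝ)..s, σ t) (σ s) s := fun s =>
    intervalIntegral.integral_hasDerivAt_right (hσi _ _)
      hσc.stronglyMeasurable.stronglyMeasurableAtFilter hσc.continuousAt
  have hd' : deriv (fun s => ∫ t in (0 : ℝ)..s, σ t) = σ := funext fun s => (hd s).deriv
  have h0 : ∀ t, 0 ≤ σ t := fun t => Real.smoothTransition.nonneg _
  have hz : ∀ s ≤ ε, ∫ t in (0 : ℝ)..s, σ t = 0 := by
    intro s hs
    rw [intervalIntegral.integral_congr (g := fun _ => 0), intervalIntegral.integral_zero]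
    intro t ht
    refine Real.smoothTransition.zero_of_nonpos ?_
    rw [sub_nonpos, div_le_one hε]
    exact ht.2.trans (sup_le hε.le hs)
  refine ⟨fun s => ∫ t in (0 : ℝ)..s, σ t, ?_, hz, fun s => ?_, fun s => ?_⟩
  · rw [contDiff_infty_iff_deriv, hd']
    exact ⟨fun s => (hd s).differentiableAt, hσs⟩
  · rw [hd', abs_of_nonneg (h0 s)]
    exact Real.smoothTransition.le_one _
  · rcases le_total s (2 * ε) with h | h
    · rcases le_total s ε with h' | h'
      · change _ ≤ ∫ t in (0 : ℝ)..s, σ t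
        rw [hz s h']
        linarith
      · exact (sub_nonpos.2 h).trans
          (intervalIntegral.integral_nonneg (hε.le.trans h') fun t _ => h0 t)
    · change _ ≤ ∫ t in (0 : ℝ)..s, σ t
      rw [← intervalIntegral.integral_add_adjacent_intervals (hσi 0 (2 * ε)) (hσi _ _)]
      have h1 : ∫ t in (2 * ε)..s, σ t = s - 2 * ε := by
        rw [intervalIntegral.integral_congr (g := fun _ => 1)]
        · simp
        · intro t ht
          refine Real.smoothTransition.one_of_one_le ?_
          rw [uIcc_of_le h] at ht
          rw [le_sub_iff_add_le, le_div_iff₀ hε]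
          linarith [ht.1]
      rw [h1]
      have h2 : 0 ≤ ∫ t in (0 : ℝ)..(2 * ε), σ t :=
        intervalIntegral.integral_nonneg (by positivity) fun t _ => h0 t
      linarith

section Ball

variable {n : ℕ}

theorem isConvexDomain_ball (x : EuclideanSpace ℝ (Fin n)) {r : ℝ} (hr : 0 < r) :
    IsConvexDomain (Metric.ball x r) :=
  ⟨Metric.nonempty_ball.2 hr, Metric.isOpen_ball, Metric.isBounded_ball, convex_ball x r⟩

theorem volume_real_ball (hn : 0 < n) (x : EuclideanSpace ℝ (Fin n)) {r : ℝ} (hr : 0 < r) :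
    volume.real (Metric.ball x r) =
      r ^ n * volume.real (Metric.ball (0 : EuclideanSpace ℝ (Fin n)) 1) := by
  have := Fin.pos_iff_nonempty.1 hn
  rw [measureReal_def, Measure.addHaar_ball _ _ hr.le, ENNReal.toReal_mul,
    ENNReal.toReal_ofReal (by positivity), finrank_euclideanSpace_fin, measureReal_def]

theorem setIntegral_norm_sq_ball (hn : 0 < n) {R : ℝ} (hR : 0 < R) :
    ∫ y in Metric.ball (0 : EuclideanSpace ℝ (Fin n)) R, ‖y‖ ^ 2 =
      n / (n + 2) * volume.real (Metric.ball (0 : EuclideanSpace ℝ (Fin n)) 1) * R ^ (n + 2) := by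
  have := Fin.pos_iff_nonempty.1 hn
  rw [← integral_indicator Metric.isOpen_ball.measurableSet]
  have e : ∀ y : EuclideanSpace ℝ (Fin n), (Metric.ball 0 R).indicator (fun y => ‖y‖ ^ 2) y =
      (Iio R).indicator (fun t => t ^ 2) ‖y‖ := fun y => by
    by_cases h : y ∈ Metric.ball 0 R
    · rw [indicator_of_mem h, indicator_of_mem (mem_Iio.2 (mem_ball_zero_iff.1 h))]
    · have h' : ‖y‖ ∉ Iio R := fun h' => h (mem_ball_zero_iff.2 h')
      rw [indicator_of_notMem h, indicator_of_notMem h']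
  simp only [e]
  rw [integral_fun_norm_addHaar, finrank_euclideanSpace_fin]
  have h : ∫ t in Ioi (0 : ℝ), t ^ (n - 1) • (Iio R).indicator (fun t => t ^ 2) t =
      R ^ (n + 2) / (n + 2) := by
    have e2 : ∀ t : ℝ, t ^ (n - 1) • (Iio R).indicator (fun t => t ^ 2) t =
        (Iio R).indicator (fun t => t ^ (n + 1)) t := fun t => by
      by_cases ht : t ∈ Iio R
      · rw [indicator_of_mem ht, indicator_of_mem ht, smul_eq_mul, ← pow_add]
        congr 1
        omega
      · rw [indicator_of_notMem ht, indicator_of_notMem ht, smul_zero]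
    simp only [e2]
    rw [setIntegral_indicator measurableSet_Iio, Ioi_inter_Iio, ← integral_Ioc_eq_integral_Ioo,
      ← intervalIntegral.integral_of_le hR.le, integral_pow]
    push_cast
    rw [zero_pow (by omega), sub_zero, add_assoc (n : ℝ) 1 1]
    norm_num
  rw [h]
  simp only [nsmul_eq_mul, smul_eq_mul]
  ring

theorem setIntegral_norm_sub_sq_ball (hn : 0 < n) (x : EuclideanSpace ℝ (Fin n)) {R : ℝ}
    (hR : 0 < R) : ∫ y in Metric.ball x R, ‖y - x‖ ^ 2 =
      n / (n + 2) * volume.real (Metric.ball (0 : EuclideanSpace ℝ (Fin n)) 1) * R ^ (n + 2) := by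
  rw [← setIntegral_norm_sq_ball hn hR,
    ← (measurePreserving_sub_right volume x).setIntegral_preimage_emb
    (measurableEmbedding_subRight x) (fun y => ‖y‖ ^ 2)]
  congr 2
  ext y
  simp [dist_eq_norm]

theorem torsionBound_ball (hn : 0 < n) (x : EuclideanSpace ℝ (Fin n)) {r : ℝ} (hr : 0 < r) :
    TorsionBound (Metric.ball x r)
      ((1 / n) ^ 2 * ∫ y in Metric.ball (0 : EuclideanSpace ℝ (Fin n)) r, ‖y‖ ^ 2) :=
  torsionBound_of_volume_eq hn (isConvexDomain_ball x hr) (isConvexDomain_ball 0 hr)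
    (by rw [volume_real_ball hn x hr, volume_real_ball hn 0 hr])

theorem le_torsionalRigidityN_ball (hn : 0 < n) (x : EuclideanSpace ℝ (Fin n)) {r ε : ℝ}
    (hr : 0 < r) (hε : 0 < ε) :
    ∫ y in Metric.ball x r, ((r ^ 2 - ‖y - x‖ ^ 2 - 2 * ε) / n - ‖y - x‖ ^ 2 / n ^ 2) ≤
      torsionalRigidityN n (Metric.ball x r) := by
  have hn' : (0 : ℝ) < n := by exact_mod_cast hn
  obtain ⟨ψ, hψ, hψ0, hψ1, hψs⟩ := exists_smooth_approx_id hε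
  set u : EuclideanSpace ℝ (Fin n) → ℝ := fun y => ψ (r ^ 2 - ‖y - x‖ ^ 2) / (2 * n) with hu_def
  have hu : ContDiff ℝ (⊤ : ℕ∞) u :=
    (hψ.comp (contDiff_const.sub ((contDiff_id.sub contDiff_const).norm_sq ℝ))).div_const _
  have hu1 : ContDiff ℝ 1 u := hu.of_le (by exact_mod_cast le_top)
  have hC : IsClosed {y | ‖y - x‖ ^ 2 ≤ r ^ 2 - ε} := isClosed_le (by fun_prop) continuous_const
  have hCb : {y | ‖y - x‖ ^ 2 ≤ r ^ 2 - ε} ⊆ Metric.ball x r := fun y hy => by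
    rw [mem_ball_iff_norm]
    have hy' : ‖y - x‖ ^ 2 ≤ r ^ 2 - ε := hy
    exact lt_of_pow_lt_pow_left₀ 2 hr.le (by linarith)
  have hus : Function.support u ⊆ {y | ‖y - x‖ ^ 2 ≤ r ^ 2 - ε} := fun y hy => by
    by_contra h
    have h' : r ^ 2 - ε < ‖y - x‖ ^ 2 := not_le.1 h
    apply hy
    simp [hu_def, hψ0 (r ^ 2 - ‖y - x‖ ^ 2) (by linarith)]
  have huc : HasCompactSupport u := HasCompactSupport.of_support_subset_isCompact
    (isCompact_closedBall x r) (hus.trans (hCb.trans Metric.ball_subset_closedBall))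
  have hsub : tsupport u ⊆ Metric.ball x r := (closure_minimal hus hC).trans hCb
  have hgrad : ∀ y, ‖gradient u y‖ ^ 2 ≤ ‖y - x‖ ^ 2 / n ^ 2 := by
    intro y
    simp only [gradient, LinearIsometryEquiv.norm_map]
    have h1 := ((hψ.differentiable (by simp) (r ^ 2 - ‖y - x‖ ^ 2)).hasDerivAt.comp_hasFDerivAt y
      (((hasFDerivAt_id y).sub_const x).norm_sq.const_sub (r ^ 2))).mul_const (2 * n : ℝ)⁻¹
    have h2 : fderiv ℝ u y = (2 * n : ℝ)⁻¹ • deriv ψ (r ^ 2 - ‖y - x‖ ^ 2) •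
        -((2 : ℕ) • innerSL ℝ (y - x)) := by
      simpa [hu_def, div_eq_mul_inv] using h1.fderiv
    have h3 : ‖fderiv ℝ u y‖ ≤ ‖y - x‖ / n := by
      rw [h2, norm_smul, norm_smul, norm_neg, ← Nat.cast_smul_eq_nsmul ℝ, norm_smul,
        innerSL_apply_norm, Real.norm_of_nonneg (by positivity), Real.norm_eq_abs]
      calc (2 * n : ℝ)⁻¹ * (|deriv ψ (r ^ 2 - ‖y - x‖ ^ 2)| * (‖((2 : ℕ) : ℝ)‖ * ‖y - x‖))
          ≤ (2 * n : ℝ)⁻¹ * (1 * (‖((2 : ℕ) : ℝ)‖ * ‖y - x‖)) := by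
            gcongr
            exact hψ1 _
        _ = ‖y - x‖ / n := by
            rw [Real.norm_of_nonneg (by positivity)]
            push_cast
            field_simp
    rw [← div_pow]
    gcongr
  refine le_trans ?_ (le_csSup ⟨_, (torsionBound_ball hn x hr).mem_upperBounds
    (isConvexDomain_ball x hr)⟩ ⟨u, hu, huc, hsub, rfl⟩)
  have hb : ∀ f : EuclideanSpace ℝ (Fin n) → ℝ, Continuous f →
      IntegrableOn f (Metric.ball x r) := fun f hf =>
    (hf.continuousOn.integrableOn_compact (isCompact_closedBall x r)).mono_set
      Metric.ball_subset_closedBall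
  have hui := hb u hu.continuous
  have hgi := (integrable_norm_gradient_sq hu1 huc).integrableOn (s := Metric.ball x r)
  rw [← integral_const_mul, ← integral_sub (hui.const_mul 2) hgi]
  refine setIntegral_mono (hb _ (by fun_prop)) ((hui.const_mul 2).sub hgi) fun y => ?_
  refine sub_le_sub ?_ (hgrad y)
  have h2 : 2 * u y = ψ (r ^ 2 - ‖y - x‖ ^ 2) / n := by
    simp only [hu_def]
    field_simp
  rw [h2]
  gcongr
  exact hψs _

theorem torsionalRigidityN_ball (hn : 0 < n) (x : EuclideanSpace ℝ (Fin n)) {r : ℝ}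
    (hr : 0 < r) : torsionalRigidityN n (Metric.ball x r) =
      volume.real (Metric.ball (0 : EuclideanSpace ℝ (Fin n)) 1) / (n * (n + 2)) *
        r ^ (n + 2) := by
  have hn' : (0 : ℝ) < n := by exact_mod_cast hn
  set ω := volume.real (Metric.ball (0 : EuclideanSpace ℝ (Fin n)) 1) with hω
  have hω0 : 0 < ω := (isConvexDomain_ball 0 one_pos).measureReal_pos
  refine le_antisymm ?_ (le_of_forall_pos_le_add fun η hη => ?_)
  · have h := (torsionBound_ball hn x hr).torsionalRigidityN_le (isConvexDomain_ball x hr)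
    rw [setIntegral_norm_sq_ball hn hr, ← hω] at h
    refine h.trans_eq ?_
    field_simp
  · have h := le_torsionalRigidityN_ball hn x hr
      (ε := η * n / (2 * (r ^ n * ω))) (by positivity)
    have hb : ∀ f : EuclideanSpace ℝ (Fin n) → ℝ, Continuous f →
        IntegrableOn f (Metric.ball x r) := fun f hf =>
      (hf.continuousOn.integrableOn_compact (isCompact_closedBall x r)).mono_set
        Metric.ball_subset_closedBall
    have e : ∀ ε : ℝ, ∫ y in Metric.ball x r,
        ((r ^ 2 - ‖y - x‖ ^ 2 - 2 * ε) / n - ‖y - x‖ ^ 2 / n ^ 2) =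
        ω / (n * (n + 2)) * r ^ (n + 2) - 2 * ε / n * (r ^ n * ω) := fun ε => by
      have e1 : ∀ y, (r ^ 2 - ‖y - x‖ ^ 2 - 2 * ε) / n - ‖y - x‖ ^ 2 / n ^ 2 =
          (r ^ 2 - 2 * ε) / n - (1 / n + 1 / n ^ 2) * ‖y - x‖ ^ 2 := fun y => by ring
      simp only [e1]
      rw [integral_sub (hb _ (by fun_prop)) (hb _ (by fun_prop)), integral_const_mul,
        setIntegral_norm_sub_sq_ball hn x hr, setIntegral_const, volume_real_ball hn x hr,
        smul_eq_mul, ← hω, pow_add]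
      field_simp
      ring
    rw [e] at h
    have h2 : 2 * (η * n / (2 * (r ^ n * ω))) / n * (r ^ n * ω) = η := by
      field_simp
    linarith

end Ball

section Equality

variable {n : ℕ} {Ω : Set (EuclideanSpace ℝ (Fin n))}

theorem IsConvexDomain.eq_of_subset {U : Set (EuclideanSpace ℝ (Fin n))} (hΩ : IsConvexDomain Ω)
    (hU : IsConvexDomain U) (hsub : Ω ⊆ U) (hvol : volume.real Ω = volume.real U) : Ω = U := by
  refine hsub.antisymm ?_
  have h0 : volume.real (U \ Ω) = 0 := by
    rw [measureReal_sdiff hsub hΩ.isOpen.measurableSet hU.measure_lt_top.ne, hvol, sub_self]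
  have h1 : volume (U \ Ω) = 0 :=
    (measureReal_eq_zero_iff (measure_ne_top_of_subset sdiff_subset hU.measure_lt_top.ne)).1 h0
  have h2 : U \ closure Ω = ∅ :=
    ((hU.isOpen.sdiff isClosed_closure).measure_eq_zero_iff volume).1
      (measure_mono_null (sdiff_subset_sdiff_right subset_closure) h1)
  rw [sdiff_eq_empty] at h2
  have h3 := hU.isOpen.subset_interior_iff.2 h2
  rwa [hΩ.convex.interior_closure_eq_interior_of_nonempty_interior
    (by rw [hΩ.isOpen.interior_eq]; exact hΩ.nonempty), hΩ.isOpen.interior_eq] at h3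

theorem exists_orthonormalBasis_apply_eq {e : EuclideanSpace ℝ (Fin n)} (he : ‖e‖ = 1)
    (i : Fin n) : ∃ b : OrthonormalBasis (Fin n) ℝ (EuclideanSpace ℝ (Fin n)), b i = e := by
  obtain ⟨b, hb⟩ := Orthonormal.exists_orthonormalBasis_extension_of_card_eq (𝕜 := ℝ)
    (E := EuclideanSpace ℝ (Fin n)) (ι := Fin n) (by simp) (v := fun _ => e) (s := {i})
    (orthonormal_subsingleton_iff.2 fun _ => he)
  exact ⟨b, hb i rfl⟩

theorem torsionalRigidityN_le (hn : 0 < n) (hΩ : IsConvexDomain Ω) {R : ℝ} (hR : 0 < R)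
    (hvol : volume.real Ω = volume.real (Metric.ball (0 : EuclideanSpace ℝ (Fin n)) R)) :
    torsionalRigidityN n Ω ≤
      volume.real (Metric.ball (0 : EuclideanSpace ℝ (Fin n)) 1) / (n * (n + 2)) *
        R ^ (n + 2) := by
  have h := (torsionBound_of_volume_eq hn hΩ (isConvexDomain_ball 0 hR)
    hvol).torsionalRigidityN_le hΩ
  rw [setIntegral_norm_sq_ball hn hR] at h
  refine h.trans_eq ?_
  field_simp

theorem eq_ball_of_torsionalRigidityN_eq (hn : 2 ≤ n) (hΩ : IsConvexDomain Ω) {R : ℝ}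
    (hR : 0 < R)
    (hvol : volume.real Ω = volume.real (Metric.ball (0 : EuclideanSpace ℝ (Fin n)) R))
    (heq : torsionalRigidityN n Ω =
      volume.real (Metric.ball (0 : EuclideanSpace ℝ (Fin n)) 1) / (n * (n + 2)) *
        R ^ (n + 2)) : ∃ x, Ω = Metric.ball x R := by
  have hn0 : 0 < n := by omega
  have hB := isConvexDomain_ball (0 : EuclideanSpace ℝ (Fin n)) hR
  set p := (volume.real Ω)⁻¹ • ∫ z in Ω, z with hp
  refine ⟨p, hΩ.eq_of_subset (isConvexDomain_ball p hR) (fun x hx => ?_) ?_⟩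
  · rw [mem_ball_iff_norm]
    by_cases hxp : x - p = 0
    · rwa [hxp, norm_zero]
    have hxp' : 0 < ‖x - p‖ := norm_pos_iff.2 hxp
    obtain ⟨b, hb⟩ := exists_orthonormalBasis_apply_eq (e := ‖x - p‖⁻¹ • (x - p))
      (by rw [norm_smul, norm_inv, norm_norm, inv_mul_cancel₀ hxp'.ne']) ⟨0, hn0⟩
    rcases exists_deficit_or_inner hn b ⟨0, hn0⟩ rfl hΩ hB hvol
      (fun y hy => by simpa using hy) with ⟨ε, hε, h⟩ | h
    · have h1 := h.torsionalRigidityN_le hΩ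
      rw [heq, setIntegral_norm_sq_ball hn0 hR] at h1
      have h2 : 0 < (1 / n : ℝ) ^ 2 * ε := by positivity
      have h3 : (1 / n : ℝ) ^ 2 * (n / (n + 2) *
          volume.real (Metric.ball (0 : EuclideanSpace ℝ (Fin n)) 1) * R ^ (n + 2)) =
          volume.real (Metric.ball (0 : EuclideanSpace ℝ (Fin n)) 1) / (n * (n + 2)) *
            R ^ (n + 2) := by
        field_simp
      rw [mul_sub, h3] at h1
      linarith
    · obtain ⟨y, hy, hyx⟩ := h x hx
      have hint : IntegrableOn (fun z : EuclideanSpace ℝ (Fin n) => z) Ω :=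
        (continuousOn_id.integrableOn_compact hΩ.isBounded.isCompact_closure).mono_set
          subset_closure
      have h1 : inner ℝ (b ⟨0, hn0⟩) y = ‖x - p‖ := by
        rw [hyx, integral_inner hint, ← real_inner_smul_right, ← hp, ← inner_sub_right, hb,
          real_inner_smul_left, real_inner_self_eq_norm_sq]
        field_simp
      rw [← h1]
      refine (real_inner_le_norm _ _).trans_lt ?_
      rw [b.norm_eq_one, one_mul]
      exact mem_ball_zero_iff.1 hy
  · rw [hvol, volume_real_ball hn0 0 hR, volume_real_ball hn0 p hR]

end Equality

end SaintVenant

open SaintVenant in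
theorem stmt_12 (n : ℕ) (hn : 2 ≤ n) (Ω : Set (EuclideanSpace ℝ (Fin n)))
    (hne : Ω.Nonempty) (hopen : IsOpen Ω) (hbdd : Bornology.IsBounded Ω)
    (hconv : Convex ℝ Ω) :
    torsionalRigidityN n Ω / volN n Ω ^ ((n + 2 : ℝ) / n) ≤
        torsionalRigidityN n (Metric.ball (0 : EuclideanSpace ℝ (Fin n)) 1) /
          volN n (Metric.ball (0 : EuclideanSpace ℝ (Fin n)) 1) ^ ((n + 2 : ℝ) / n) ∧
      (torsionalRigidityN n Ω / volN n Ω ^ ((n + 2 : ℝ) / n) =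
          torsionalRigidityN n (Metric.ball (0 : EuclideanSpace ℝ (Fin n)) 1) /
            volN n (Metric.ball (0 : EuclideanSpace ℝ (Fin n)) 1) ^ ((n + 2 : ℝ) / n) ↔
        ∃ (x₀ : EuclideanSpace ℝ (Fin n)) (r : ℝ), 0 < r ∧ Ω = Metric.ball x₀ r) := by
  have hΩ : IsConvexDomain Ω := ⟨hne, hopen, hbdd, hconv⟩
  have hn0 : 0 < n := by omega
  have hn' : (0 : ℝ) < n := by exact_mod_cast hn0
  set ω := volume.real (Metric.ball (0 : EuclideanSpace ℝ (Fin n)) 1) with hω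
  have hω0 : 0 < ω := (isConvexDomain_ball 0 one_pos).measureReal_pos
  have hv := hΩ.measureReal_pos
  set R : ℝ := (volume.real Ω / ω) ^ (1 / (n : ℝ)) with hRdef
  have hR : 0 < R := by positivity
  have hRn : R ^ n = volume.real Ω / ω := by
    rw [hRdef, ← Real.rpow_natCast, ← Real.rpow_mul (by positivity), one_div_mul_cancel hn'.ne',
      Real.rpow_one]
  have hvol : volume.real Ω = R ^ n * ω := by
    rw [hRn, div_mul_cancel₀ _ hω0.ne']
  have hvolR : volume.real Ω = volume.real (Metric.ball (0 : EuclideanSpace ℝ (Fin n)) R) := by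
    rw [volume_real_ball hn0 0 hR, hvol]
  have e1 : volN n Ω ^ ((n + 2 : ℝ) / n) = R ^ (n + 2) * ω ^ ((n + 2 : ℝ) / n) := by
    change volume.real Ω ^ ((n + 2 : ℝ) / n) = _
    rw [hvol, Real.mul_rpow (by positivity) hω0.le, ← Real.rpow_natCast R n,
      ← Real.rpow_mul hR.le, mul_div_cancel₀ _ hn'.ne', ← Real.rpow_natCast R (n + 2)]
    push_cast
    rfl
  have e2 : volN n (Metric.ball (0 : EuclideanSpace ℝ (Fin n)) 1) = ω := rfl
  have hD : 0 < ω ^ ((n + 2 : ℝ) / n) := by positivity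
  have hRD : 0 < R ^ (n + 2) * ω ^ ((n + 2 : ℝ) / n) := by positivity
  have e3 : ω / (n * (n + 2)) / ω ^ ((n + 2 : ℝ) / n) =
      ω / (n * (n + 2)) * R ^ (n + 2) / (R ^ (n + 2) * ω ^ ((n + 2 : ℝ) / n)) := by
    field_simp
  rw [e1, e2, torsionalRigidityN_ball hn0 0 one_pos, ← hω, one_pow, mul_one, e3]
  refine ⟨?_, ?_⟩
  · gcongr
    exact torsionalRigidityN_le hn0 hΩ hR hvolR
  · rw [div_left_inj' hRD.ne']
    constructor
    · intro h
      obtain ⟨x, hx⟩ := eq_ball_of_torsionalRigidityN_eq hn hΩ hR hvolR h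
      exact ⟨x, R, hR, hx⟩
    · rintro ⟨x, r, hr, rfl⟩
      rw [volume_real_ball hn0 x hr, mul_left_inj' hω0.ne'] at hvol
      rw [torsionalRigidityN_ball hn0 x hr, (pow_left_inj₀ hr.le hR.le hn0.ne').1 hvol]
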